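/- Let t > 0, let E₀ ⊂ [0, t) be a nonempty closed set, set E_n := E₀ + tn for all n ∈ ℕ (or for all n ∈ ℤ), and let Ω := ℂ \ ⋃_n E_n. Then neither the Poincaré metric space (Ω, h_Ω) nor the quasihyperbolic metric space (Ω, k_Ω) is Gromov hyperbolic. -/

import Mathlib

open Set Metric Filter Complex

noncomputable section

/-- The length of a curve `γ : [0,1] → E` with respect to the conformal density `ρ`. -/
def curveLen {E : Type*} [NormedAddCommGroup E] [NormedSpace ℝ E]
    (ρ : E → ℝ) (γ : ℝ → E) : ℝ :=
  ∫ t in (0:ℝ)..1, ρ (γ t) * ‖deriv γ t‖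

/-- The distance induced on the set `S` by the conformal density `ρ`, defined as the infimum
of the `ρ`-lengths of C¹ curves joining the two points inside `S`. -/
def densityDist {E : Type*} [NormedAddCommGroup E] [NormedSpace ℝ E]
    (S : Set E) (ρ : E → ℝ) (z w : E) : ℝ :=
  sInf { L | ∃ γ : ℝ → E, ContDiffOn ℝ 1 γ (Icc 0 1) ∧ γ 0 = z ∧ γ 1 = w ∧
      (∀ t ∈ Icc (0:ℝ) 1, γ t ∈ S) ∧ L = curveLen ρ γ }

/-- The quasihyperbolic density `1/δ_Ω(z)` of a domain `Ω`. -/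
def qhDensity {E : Type*} [NormedAddCommGroup E] [NormedSpace ℝ E] (Ω : Set E) : E → ℝ :=
  fun z => (Metric.infDist z Ωᶜ)⁻¹

/-- The quasihyperbolic distance of a domain `Ω`. -/
def qhDist {E : Type*} [NormedAddCommGroup E] [NormedSpace ℝ E] (Ω : Set E) : E → E → ℝ :=
  densityDist Ω (qhDensity Ω)

/-- `lam` is the density of the Poincaré (hyperbolic) metric of the plane domain `Ω`:
it is the pushforward of the density `2/(1-|z|²)` of the unit disk under a holomorphic
universal covering map `p : 𝔻 → Ω`. -/
def IsPoincareDensity (Ω : Set ℂ) (lam : ℂ → ℝ) : Prop :=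
  ∃ p : ℂ → ℂ,
    (∀ z ∈ ball (0:ℂ) 1, DifferentiableAt ℂ p z) ∧
    p '' ball (0:ℂ) 1 = Ω ∧
    IsCoveringMapOn (fun z : ball (0:ℂ) 1 => p z) Ω ∧
    ∀ z ∈ ball (0:ℂ) 1, lam (p z) * ‖deriv p z‖ = 2 / (1 - ‖z‖ ^ 2)

/-- `g` is a geodesic in `(S, d)` from `x` to `y`, parametrized by arclength on
`[0, d x y]`. -/
def IsGeodesicIn {α : Type*} (S : Set α) (d : α → α → ℝ) (g : ℝ → α) (x y : α) : Prop :=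
  g 0 = x ∧ g (d x y) = y ∧ (∀ t ∈ Icc (0:ℝ) (d x y), g t ∈ S) ∧
  ∀ s ∈ Icc (0:ℝ) (d x y), ∀ t ∈ Icc (0:ℝ) (d x y), d (g s) (g t) = |s - t|

/-- Every geodesic triangle of `(S, d)` is `δ`-thin (Rips condition). -/
def GromovHyperbolicWith {α : Type*} (S : Set α) (d : α → α → ℝ) (δ : ℝ) : Prop :=
  ∀ x ∈ S, ∀ y ∈ S, ∀ z ∈ S, ∀ gxy gxz gzy : ℝ → α,
    IsGeodesicIn S d gxy x y → IsGeodesicIn S d gxz x z → IsGeodesicIn S d gzy z y →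
    ∀ t ∈ Icc (0:ℝ) (d x y),
      ∃ p ∈ gxz '' Icc (0:ℝ) (d x z) ∪ gzy '' Icc (0:ℝ) (d z y), d (gxy t) p ≤ δ

/-- `(S, d)` is Gromov hyperbolic: some `δ ≥ 0` works for all geodesic triangles. -/
def IsGromovHyperbolic {α : Type*} (S : Set α) (d : α → α → ℝ) : Prop :=
  ∃ δ : ℝ, 0 ≤ δ ∧ GromovHyperbolicWith S d δ

/-- The real axis inside `ℂ`. -/
def realLine : Set ℂ := {z : ℂ | z.im = 0}

/-- A Denjoy domain: a domain whose boundary is contained in the real axis. -/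
def IsDenjoyDomain (Ω : Set ℂ) : Prop :=
  IsOpen Ω ∧ IsConnected Ω ∧ frontier Ω ⊆ realLine

/-- The distance (for the distance function `d`) from a point to a set. -/
def distToSet {α : Type*} (d : α → α → ℝ) (z : α) (A : Set α) : ℝ :=
  sInf (d z '' A)

/-- A fundamental geodesic: a geodesic of `(S, d)` contained in the closed upper half plane,
joining a point of the boundary interval `I` (on the real axis) to a point of the boundary
interval `J`. -/
def IsFundGeodesic (S : Set ℂ) (d : ℂ → ℂ → ℝ) (I J : Set ℝ) (g : ℝ → ℂ) (x y : ℂ) : Prop :=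
  IsGeodesicIn S d g x y ∧ x.im = 0 ∧ x.re ∈ I ∧ y.im = 0 ∧ y.re ∈ J ∧
  ∀ t ∈ Icc (0:ℝ) (d x y), 0 ≤ (g t).im

end

noncomputable section

/-- `γ` is a `C¹` curve on `[0,1]` inside `S` from `z` to `w`. -/
def IsC1CurveIn (S : Set ℂ) (z w : ℂ) (γ : ℝ → ℂ) : Prop :=
  ContDiffOn ℝ 1 γ (Icc 0 1) ∧ γ 0 = z ∧ γ 1 = w ∧ ∀ t ∈ Icc (0:ℝ) 1, γ t ∈ S

/-- The standing assumptions on a conformal density: it is continuous and positive on the open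
set `S`, any two points of which are joined by a `C¹` curve in `S`. -/
structure IsConformalDensity (S : Set ℂ) (ρ : ℂ → ℝ) : Prop where
  isOpen : IsOpen S
  continuousOn : ContinuousOn ρ S
  pos : ∀ z ∈ S, 0 < ρ z
  joined : ∀ z ∈ S, ∀ w ∈ S, ∃ γ, IsC1CurveIn S z w γ

variable {S : Set ℂ} {ρ : ℂ → ℝ} {z w x y : ℂ} {γ γ₁ γ₂ : ℝ → ℂ}

lemma deriv_eq_derivWithin_Icc {γ : ℝ → ℂ} {s : ℝ} (hs : s ∈ Ioo (0:ℝ) 1) :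
    deriv γ s = derivWithin γ (Icc 0 1) s :=
  (derivWithin_of_mem_nhds (Icc_mem_nhds hs.1 hs.2)).symm

lemma IsC1CurveIn.continuousOn_derivWithin (h : IsC1CurveIn S z w γ) :
    ContinuousOn (derivWithin γ (Icc 0 1)) (Icc 0 1) :=
  h.1.continuousOn_derivWithin (uniqueDiffOn_Icc zero_lt_one) le_rfl

lemma IsC1CurveIn.hasDerivAt (h : IsC1CurveIn S z w γ) {s : ℝ} (hs : s ∈ Ioo (0:ℝ) 1) :
    HasDerivAt γ (derivWithin γ (Icc 0 1) s) s := by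
  rw [← deriv_eq_derivWithin_Icc hs]
  exact ((h.1.differentiableOn one_ne_zero s (Ioo_subset_Icc_self hs)).differentiableAt
    (Icc_mem_nhds hs.1 hs.2)).hasDerivAt

lemma integral_speed_eq {a b : ℝ} (ha : 0 ≤ a) (hab : a ≤ b) (hb : b ≤ 1) :
    ∫ t in a..b, ρ (γ t) * ‖deriv γ t‖ =
      ∫ t in a..b, ρ (γ t) * ‖derivWithin γ (Icc 0 1) t‖ := by
  apply intervalIntegral.integral_congr_uIoo
  intro t ht
  rw [uIoo_of_le hab] at ht
  simp only [deriv_eq_derivWithin_Icc (γ := γ) ⟨ha.trans_lt ht.1, ht.2.trans_le hb⟩]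

lemma IsC1CurveIn.continuousOn_speed (h : IsC1CurveIn S z w γ) (hρ : ContinuousOn ρ S) :
    ContinuousOn (fun t => ρ (γ t) * ‖derivWithin γ (Icc 0 1) t‖) (Icc 0 1) :=
  (hρ.comp h.1.continuousOn h.2.2.2).mul h.continuousOn_derivWithin.norm

lemma IsC1CurveIn.intervalIntegrable (h : IsC1CurveIn S z w γ) (hρ : ContinuousOn ρ S)
    {a b : ℝ} (ha : 0 ≤ a) (hab : a ≤ b) (hb : b ≤ 1) :
    IntervalIntegrable (fun t => ρ (γ t) * ‖deriv γ t‖) MeasureTheory.volume a b := by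
  have h1 : IntervalIntegrable (fun t => ρ (γ t) * ‖derivWithin γ (Icc 0 1) t‖)
      MeasureTheory.volume a b := by
    apply ContinuousOn.intervalIntegrable
    rw [uIcc_of_le hab]
    exact (h.continuousOn_speed hρ).mono (Icc_subset_Icc ha hb)
  refine h1.congr_uIoo ?_
  intro t ht
  rw [uIoo_of_le hab] at ht
  simp only [deriv_eq_derivWithin_Icc (γ := γ) ⟨ha.trans_lt ht.1, ht.2.trans_le hb⟩]

lemma IsC1CurveIn.speed_nonneg (h : IsC1CurveIn S z w γ) (hρ : ∀ z ∈ S, 0 < ρ z) {t : ℝ}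
    (ht : t ∈ Icc (0:ℝ) 1) : 0 ≤ ρ (γ t) * ‖deriv γ t‖ :=
  mul_nonneg (hρ _ (h.2.2.2 t ht)).le (norm_nonneg _)

lemma IsC1CurveIn.curveLen_nonneg (h : IsC1CurveIn S z w γ) (hρ : ∀ z ∈ S, 0 < ρ z) :
    0 ≤ curveLen ρ γ :=
  intervalIntegral.integral_nonneg zero_le_one fun _ ht => h.speed_nonneg hρ ht

lemma densityDist_le (hρ : ∀ z ∈ S, 0 < ρ z) (h : IsC1CurveIn S z w γ) :
    densityDist S ρ z w ≤ curveLen ρ γ := by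
  refine csInf_le ⟨0, ?_⟩ ⟨γ, h.1, h.2.1, h.2.2.1, h.2.2.2, rfl⟩
  rintro L ⟨γ, h1, h2, h3, h4, rfl⟩
  exact IsC1CurveIn.curveLen_nonneg ⟨h1, h2, h3, h4⟩ hρ

lemma densityDist_nonneg (hρ : ∀ z ∈ S, 0 < ρ z) : 0 ≤ densityDist S ρ z w := by
  refine Real.sInf_nonneg ?_
  rintro L ⟨γ, h1, h2, h3, h4, rfl⟩
  exact IsC1CurveIn.curveLen_nonneg ⟨h1, h2, h3, h4⟩ hρ

/-- The affine restriction of a curve to `[a,b]`; for `a > b` it reverses the orientation. -/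
lemma IsC1CurveIn.restrict (h : IsC1CurveIn S z w γ) {a b : ℝ} (ha : a ∈ Icc (0:ℝ) 1)
    (hb : b ∈ Icc (0:ℝ) 1) :
    IsC1CurveIn S (γ a) (γ b) (fun s => γ (a + (b - a) * s)) ∧
      curveLen ρ (fun s => γ (a + (b - a) * s)) =
        |b - a| * ∫ s in (0:ℝ)..1, ρ (γ (a + (b - a) * s)) * ‖deriv γ (a + (b - a) * s)‖ := by
  have hmap : MapsTo (fun s : ℝ => a + (b - a) * s) (Icc 0 1) (Icc 0 1) := by
    intro s hs
    obtain ⟨h1, h2⟩ := hs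
    obtain ⟨h3, h4⟩ := ha
    obtain ⟨h5, h6⟩ := hb
    constructor <;> dsimp only <;> nlinarith
  refine ⟨⟨h.1.comp (by fun_prop) hmap, by simp, by simp, fun t ht => h.2.2.2 _ (hmap ht)⟩, ?_⟩
  rw [← intervalIntegral.integral_const_mul]
  refine intervalIntegral.integral_congr fun s _ => ?_
  have h1 : deriv (fun s => γ (a + (b - a) * s)) s = (b - a) • deriv γ (a + (b - a) * s) := by
    rw [deriv_comp_mul_left (b - a) (fun u => γ (a + u)) s, deriv_comp_const_add]
  simp only [h1, norm_smul, Real.norm_eq_abs]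
  ring

lemma IsC1CurveIn.densityDist_le_integral (h : IsC1CurveIn S z w γ) (hρ : ∀ z ∈ S, 0 < ρ z)
    {a b : ℝ} (ha : 0 ≤ a) (hab : a ≤ b) (hb : b ≤ 1) :
    densityDist S ρ (γ a) (γ b) ≤ ∫ t in a..b, ρ (γ t) * ‖deriv γ t‖ := by
  obtain ⟨h1, h2⟩ := h.restrict (ρ := ρ) (a := a) (b := b) ⟨ha, hab.trans hb⟩ ⟨ha.trans hab, hb⟩
  refine (densityDist_le hρ h1).trans (le_of_eq ?_)
  have := intervalIntegral.smul_integral_comp_add_mul (a := 0) (b := 1)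
    (fun t => ρ (γ t) * ‖deriv γ t‖) (b - a) a
  rw [h2, abs_of_nonneg (by linarith), ← smul_eq_mul, this]
  simp

lemma IsC1CurveIn.reverse (h : IsC1CurveIn S z w γ) :
    ∃ γ', IsC1CurveIn S w z γ' ∧ curveLen ρ γ' = curveLen ρ γ := by
  obtain ⟨h1, h2⟩ := h.restrict (ρ := ρ) (a := 1) (b := 0) (by simp) (by simp)
  rw [h.2.1, h.2.2.1] at h1
  refine ⟨_, h1, h2.trans ?_⟩
  have := intervalIntegral.smul_integral_comp_add_mul (a := 0) (b := 1)
    (fun t => ρ (γ t) * ‖deriv γ t‖) (0 - 1) 1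
  rw [show (1:ℝ) + (0 - 1) * 0 = 1 by norm_num, show (1:ℝ) + (0 - 1) * 1 = 0 by norm_num,
    intervalIntegral.integral_symm 0 1, smul_eq_mul] at this
  rw [show |(0:ℝ) - 1| = 1 by norm_num, curveLen]
  linarith

lemma densityDist_self (hρ : ∀ z ∈ S, 0 < ρ z) (hz : z ∈ S) : densityDist S ρ z z = 0 := by
  refine le_antisymm ?_ (densityDist_nonneg hρ)
  have h : IsC1CurveIn S z z (fun _ => z) := ⟨contDiffOn_const, rfl, rfl, fun _ _ => hz⟩
  refine (densityDist_le hρ h).trans (le_of_eq ?_)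
  simp [curveLen]

lemma exists_curveLen_lt (hρ : IsConformalDensity S ρ) (hz : z ∈ S) (hw : w ∈ S) {L : ℝ}
    (hL : densityDist S ρ z w < L) : ∃ γ, IsC1CurveIn S z w γ ∧ curveLen ρ γ < L := by
  obtain ⟨γ, hγ⟩ := hρ.joined z hz w hw
  obtain ⟨_, ⟨γ, h1, h2, h3, h4, rfl⟩, h5⟩ := exists_lt_of_csInf_lt
    (by exact ⟨_, γ, hγ.1, hγ.2.1, hγ.2.2.1, hγ.2.2.2, rfl⟩) hL
  exact ⟨γ, ⟨h1, h2, h3, h4⟩, h5⟩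

lemma densityDist_comm_le (hρ : IsConformalDensity S ρ) (hz : z ∈ S) (hw : w ∈ S) :
    densityDist S ρ w z ≤ densityDist S ρ z w := by
  refine le_of_forall_gt fun L hL => ?_
  obtain ⟨γ, h1, h2⟩ := exists_curveLen_lt hρ hz hw hL
  obtain ⟨γ', h3, h4⟩ := h1.reverse (ρ := ρ)
  exact (densityDist_le hρ.pos h3).trans_lt (h4 ▸ h2)

lemma densityDist_comm (hρ : IsConformalDensity S ρ) (hz : z ∈ S) (hw : w ∈ S) :
    densityDist S ρ z w = densityDist S ρ w z :=
  le_antisymm (densityDist_comm_le hρ hw hz) (densityDist_comm_le hρ hz hw)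

/-- Reparametrization by a monotone smooth function. -/
lemma IsC1CurveIn.integral_comp (h : IsC1CurveIn S z w γ) {u : ℝ → ℝ} (hu : ContDiff ℝ 1 u)
    (hmono : Monotone u) {a b : ℝ} (hab : a ≤ b)
    (hint : ∀ s ∈ Ioo a b, u s ∈ Ioo (0:ℝ) 1) :
    ∫ s in a..b, ρ (γ (u s)) * ‖deriv (γ ∘ u) s‖ =
      ∫ t in (u a)..(u b), ρ (γ t) * ‖deriv γ t‖ := by
  rw [← intervalIntegral.integral_comp_mul_deriv_of_deriv_nonneg (f' := deriv u)
    hu.continuous.continuousOn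
    (fun s _ => (hu.differentiable one_ne_zero s).hasDerivAt) fun s _ => hmono.deriv_nonneg]
  apply intervalIntegral.integral_congr_uIoo
  intro s hs
  rw [uIoo_of_le hab] at hs
  have h1 := (h.hasDerivAt (hint s hs)).scomp s (hu.differentiable one_ne_zero s).hasDerivAt
  simp only [Function.comp_apply]
  rw [h1.deriv, norm_smul, deriv_eq_derivWithin_Icc (hint s hs), Real.norm_eq_abs,
    abs_of_nonneg hmono.deriv_nonneg]
  ring

lemma IsC1CurveIn.trans (h₁ : IsC1CurveIn S x y γ₁) (h₂ : IsC1CurveIn S y z γ₂)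
    (hρ : ContinuousOn ρ S) :
    ∃ γ, IsC1CurveIn S x z γ ∧ curveLen ρ γ = curveLen ρ γ₁ + curveLen ρ γ₂ := by
  set φ := Real.smoothTransition
  have hφ : ContDiff ℝ 1 φ := Real.smoothTransition.contDiff (n := 1)
  have hm : ∀ s, φ s ∈ Icc (0:ℝ) 1 := fun s =>
    ⟨Real.smoothTransition.nonneg s, Real.smoothTransition.le_one s⟩
  have hI : ∀ s ∈ Ioo (0:ℝ) 1, φ s ∈ Ioo (0:ℝ) 1 := fun s hs =>
    ⟨Real.smoothTransition.pos_of_pos hs.1, Real.smoothTransition.lt_one_of_lt_one hs.2⟩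
  set u : ℝ → ℝ := fun s => φ (2 * s) with hu_def
  set v : ℝ → ℝ := fun s => φ (2 * s - 1) with hv_def
  have hu : ContDiff ℝ 1 u := hφ.comp (by fun_prop)
  have hv : ContDiff ℝ 1 v := hφ.comp (by fun_prop)
  have hum : Monotone u := fun a b hab => Real.smoothTransition.monotone (by linarith)
  have hvm : Monotone v := fun a b hab => Real.smoothTransition.monotone (by linarith)
  have ha : ContDiff ℝ 1 (γ₁ ∘ u) := h₁.1.comp_contDiff hu fun s => hm _
  have hb : ContDiff ℝ 1 (γ₂ ∘ v) := h₂.1.comp_contDiff hv fun s => hm _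
  have hu1 : ∀ s, 1 / 2 ≤ s → u s = 1 := fun s hs =>
    Real.smoothTransition.one_of_one_le (by linarith)
  have hv0 : ∀ s, s ≤ 1 / 2 → v s = 0 := fun s hs =>
    Real.smoothTransition.zero_of_nonpos (by linarith)
  set γ : ℝ → ℂ := fun s => γ₁ (u s) + γ₂ (v s) - y with hγ_def
  have hγl : ∀ s, s ≤ 1 / 2 → γ s = γ₁ (u s) := fun s hs => by
    simp [hγ_def, hv0 s hs, h₂.2.1]
  have hγr : ∀ s, 1 / 2 ≤ s → γ s = γ₂ (v s) := fun s hs => by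
    simp [hγ_def, hu1 s hs, h₁.2.2.1]
  have hγ : IsC1CurveIn S x z γ := by
    refine ⟨((ha.add hb).sub contDiff_const).contDiffOn, ?_, ?_, ?_⟩
    · rw [hγl 0 (by norm_num)]
      simp [hu_def, φ, h₁.2.1]
    · rw [hγr 1 (by norm_num)]
      norm_num [hv_def, φ, h₂.2.2.1]
    · intro t ht
      rcases le_total t (1 / 2) with h | h
      · rw [hγl t h]; exact h₁.2.2.2 _ (hm _)
      · rw [hγr t h]; exact h₂.2.2.2 _ (hm _)
  refine ⟨γ, hγ, ?_⟩
  have hl : ∫ s in (0:ℝ)..(1/2), ρ (γ s) * ‖deriv γ s‖ = curveLen ρ γ₁ := by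
    have := h₁.integral_comp (ρ := ρ) hu hum (a := 0) (b := 1/2) (by norm_num)
      (fun s hs => hI _ ⟨by linarith [hs.1], by linarith [hs.2]⟩)
    rw [hu1 _ le_rfl, show u 0 = 0 by simp [hu_def, φ]] at this
    rw [curveLen, ← this]
    apply intervalIntegral.integral_congr_uIoo
    intro s hs
    rw [uIoo_of_le (by norm_num)] at hs
    have : γ =ᶠ[nhds s] γ₁ ∘ u := by
      filter_upwards [Iio_mem_nhds hs.2] with r hr using hγl r (le_of_lt hr)
    simp only [this.deriv_eq, hγl s hs.2.le]
  have hr : ∫ s in (1/2:ℝ)..1, ρ (γ s) * ‖deriv γ s‖ = curveLen ρ γ₂ := by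
    have := h₂.integral_comp (ρ := ρ) hv hvm (a := 1/2) (b := 1) (by norm_num)
      (fun s hs => hI _ ⟨by linarith [hs.1], by linarith [hs.2]⟩)
    rw [hv0 _ le_rfl, show v 1 = 1 by norm_num [hv_def, φ]] at this
    rw [curveLen, ← this]
    apply intervalIntegral.integral_congr_uIoo
    intro s hs
    rw [uIoo_of_le (by norm_num)] at hs
    have : γ =ᶠ[nhds s] γ₂ ∘ v := by
      filter_upwards [Ioi_mem_nhds hs.1] with r hr using hγr r (le_of_lt hr)
    simp only [this.deriv_eq, hγr s hs.1.le]
  rw [← hl, ← hr, curveLen, intervalIntegral.integral_add_adjacent_intervals]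
  · exact hγ.intervalIntegrable hρ le_rfl (by norm_num) (by norm_num)
  · exact hγ.intervalIntegrable hρ (by norm_num) (by norm_num) le_rfl

lemma densityDist_triangle (hρ : IsConformalDensity S ρ) (hx : x ∈ S) (hy : y ∈ S) (hz : z ∈ S) :
    densityDist S ρ x z ≤ densityDist S ρ x y + densityDist S ρ y z := by
  refine le_of_forall_pos_le_add fun ε hε => ?_
  obtain ⟨γ₁, h1, h1'⟩ := exists_curveLen_lt hρ hx hy (lt_add_of_pos_right _ (half_pos hε))
  obtain ⟨γ₂, h2, h2'⟩ := exists_curveLen_lt hρ hy hz (lt_add_of_pos_right _ (half_pos hε))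
  obtain ⟨γ, h3, h3'⟩ := h1.trans h2 hρ.continuousOn
  linarith [densityDist_le hρ.pos h3]

/-- Bound for the distance by the length of a segment. -/
lemma densityDist_le_segment (hρ : ∀ z ∈ S, 0 < ρ z)
    (hS : ∀ s ∈ Icc (0:ℝ) 1, z + s * (w - z) ∈ S) :
    densityDist S ρ z w ≤ ∫ s in (0:ℝ)..1, ρ (z + s * (w - z)) * ‖w - z‖ := by
  have h : IsC1CurveIn S z w (fun s : ℝ => z + s * (w - z)) := by
    refine ⟨ContDiff.contDiffOn ?_, by simp, by simp, hS⟩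
    exact contDiff_const.add (ofRealCLM.contDiff.mul contDiff_const)
  refine (densityDist_le hρ h).trans (le_of_eq ?_)
  refine intervalIntegral.integral_congr fun s _ => ?_
  have h1 : HasDerivAt (fun s : ℝ => z + s * (w - z)) (1 * (w - z)) s :=
    ((ofRealCLM.hasDerivAt (x := s)).mul_const (w - z)).const_add z
  simp only [h1.deriv, one_mul]

lemma densityDist_le_mul_of_segment (hρ : ∀ z ∈ S, 0 < ρ z) {B : ℝ}
    (hS : ∀ s ∈ Icc (0:ℝ) 1, z + s * (w - z) ∈ S ∧ ρ (z + s * (w - z)) ≤ B) :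
    densityDist S ρ z w ≤ B * ‖w - z‖ := by
  refine (densityDist_le_segment hρ fun s hs => (hS s hs).1).trans ?_
  have hB : 0 ≤ B := by
    obtain ⟨h1, h2⟩ := hS 0 (by simp)
    exact (hρ _ h1).le.trans h2
  have := intervalIntegral.norm_integral_le_of_norm_le_const (a := 0) (b := 1)
    (f := fun s : ℝ => ρ (z + s * (w - z)) * ‖w - z‖) (C := B * ‖w - z‖) (by
      intro s hs
      rw [uIoc_of_le zero_le_one] at hs
      obtain ⟨h1, h2⟩ := hS s (Ioc_subset_Icc_self hs)
      rw [norm_mul, norm_norm, Real.norm_of_nonneg (hρ _ h1).le]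
      gcongr)
  simpa using (le_abs_self _).trans this

/-- A curve along which the density is at least `c / (K + distance to the starting point)` has at
least logarithmic length. -/
lemma IsC1CurveIn.mul_log_le_curveLen (h : IsC1CurveIn S z w γ) (hρ : ContinuousOn ρ S)
    {c K : ℝ} (hc : 0 < c) (hK : 0 < K)
    (hlow : ∀ s ∈ Icc (0:ℝ) 1, c / (K + ‖γ s - z‖) ≤ ρ (γ s)) :
    c * Real.log (1 + ‖w - z‖ / K) ≤ curveLen ρ γ := by
  set v : ℝ → ℝ := IccExtend (zero_le_one' ℝ) (fun t : Icc (0:ℝ) 1 =>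
    ‖derivWithin γ (Icc 0 1) t‖) with hv_def
  have hv : Continuous v :=
    Continuous.Icc_extend'
      (continuousOn_iff_continuous_domRestrict.1 h.continuousOn_derivWithin).norm
  have hv_eq : ∀ t ∈ Icc (0:ℝ) 1, v t = ‖derivWithin γ (Icc 0 1) t‖ := fun t ht => by
    rw [hv_def, IccExtend_of_mem _ _ ht]
  have hv0 : ∀ t, 0 ≤ v t := fun t => norm_nonneg _
  set m : ℝ → ℝ := fun s => ∫ t in (0:ℝ)..s, v t with hm_def
  have hm : ∀ s, HasDerivAt m (v s) s := fun s =>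
    intervalIntegral.integral_hasDerivAt_right (hv.intervalIntegrable _ _)
      (hv.stronglyMeasurableAtFilter _ _) hv.continuousAt
  have hm0 : ∀ s, 0 ≤ s → 0 ≤ m s := fun s hs =>
    intervalIntegral.integral_nonneg hs fun t _ => hv0 t
  have hdist : ∀ s ∈ Icc (0:ℝ) 1, ‖γ s - z‖ ≤ m s := by
    intro s hs
    have hsub : Icc 0 s ⊆ Icc (0:ℝ) 1 := Icc_subset_Icc le_rfl hs.2
    have h1 : ∫ t in (0:ℝ)..s, derivWithin γ (Icc 0 1) t = γ s - γ 0 := by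
      refine intervalIntegral.integral_eq_sub_of_hasDerivAt_of_le hs.1
        (h.1.continuousOn.mono hsub)
        (fun t ht => h.hasDerivAt ⟨ht.1, ht.2.trans_le hs.2⟩) ?_
      apply ContinuousOn.intervalIntegrable
      rw [uIcc_of_le hs.1]
      exact h.continuousOn_derivWithin.mono hsub
    rw [← h.2.1, ← h1]
    refine (intervalIntegral.norm_integral_le_integral_norm hs.1).trans (le_of_eq ?_)
    refine intervalIntegral.integral_congr fun t ht => ?_
    rw [uIcc_of_le hs.1] at ht
    exact (hv_eq t (hsub ht)).symm
  have hpos : ∀ s ∈ Icc (0:ℝ) 1, 0 < K + m s := fun s hs => by linarith [hm0 s hs.1]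
  have hint : ∫ s in (0:ℝ)..1, c * (v s / (K + m s)) =
      c * Real.log (K + m 1) - c * Real.log (K + m 0) := by
    refine intervalIntegral.integral_eq_sub_of_hasDerivAt (f := fun s => c * Real.log (K + m s))
      (fun s hs => ?_) ?_
    · rw [uIcc_of_le zero_le_one] at hs
      exact (((hm s).const_add K).log (hpos s hs).ne').const_mul c
    · apply ContinuousOn.intervalIntegrable
      rw [uIcc_of_le zero_le_one]
      refine continuousOn_const.mul (hv.continuousOn.div (continuousOn_const.add ?_)
        fun s hs => (hpos s hs).ne')
      exact fun s _ => (hm s).continuousAt.continuousWithinAt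
  have hm00 : m 0 = 0 := by simp [hm_def]
  have hle : c * Real.log (1 + ‖w - z‖ / K) ≤ ∫ s in (0:ℝ)..1, c * (v s / (K + m s)) := by
    rw [hint, hm00, add_zero, ← mul_sub, ← Real.log_div (hpos 1 (by simp)).ne' hK.ne']
    have := hdist 1 (by simp)
    rw [h.2.2.1] at this
    rw [add_div, div_self hK.ne']
    gcongr
  refine hle.trans ?_
  rw [curveLen, integral_speed_eq le_rfl zero_le_one le_rfl]
  refine intervalIntegral.integral_mono_on zero_le_one ?_ ?_ fun s hs => ?_
  · apply ContinuousOn.intervalIntegrable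
    rw [uIcc_of_le zero_le_one]
    refine continuousOn_const.mul (hv.continuousOn.div (continuousOn_const.add ?_)
      fun s hs => (hpos s hs).ne')
    exact fun s _ => (hm s).continuousAt.continuousWithinAt
  · apply ContinuousOn.intervalIntegrable
    rw [uIcc_of_le zero_le_one]
    exact h.continuousOn_speed hρ
  · rw [← hv_eq s hs, ← mul_div_assoc, mul_div_right_comm]
    refine mul_le_mul_of_nonneg_right (le_trans ?_ (hlow s hs)) (hv0 s)
    have := hdist s hs
    gcongr

lemma mul_log_le_densityDist (hρ : IsConformalDensity S ρ) (hz : z ∈ S) (hw : w ∈ S)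
    {c : ℝ} (hc : 0 < c) {ψ : ℂ → ℝ} (hψ : ∀ z ∈ S, 0 < ψ z)
    (hlip : ∀ z w, ψ z ≤ ψ w + ‖z - w‖) (hlow : ∀ z ∈ S, c / ψ z ≤ ρ z) :
    c * Real.log (1 + ‖w - z‖ / ψ z) ≤ densityDist S ρ z w := by
  refine le_of_forall_gt fun L hL => ?_
  obtain ⟨γ, h1, h2⟩ := exists_curveLen_lt hρ hz hw hL
  refine lt_of_le_of_lt (h1.mul_log_le_curveLen hρ.continuousOn hc (hψ z hz) fun s hs => ?_) h2
  have hs' := h1.2.2.2 s hs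
  refine le_trans ?_ (hlow _ hs')
  have := hψ _ hs'
  have := hlip (γ s) z
  gcongr

lemma norm_sub_le_of_densityDist_le (hρ : IsConformalDensity S ρ) (hz : z ∈ S) (hw : w ∈ S)
    {c : ℝ} (hc : 0 < c) {ψ : ℂ → ℝ} (hψ : ∀ z ∈ S, 0 < ψ z)
    (hlip : ∀ z w, ψ z ≤ ψ w + ‖z - w‖) (hlow : ∀ z ∈ S, c / ψ z ≤ ρ z) {D : ℝ}
    (hD : densityDist S ρ z w ≤ D) :
    ‖w - z‖ ≤ ψ z * (Real.exp (D / c) - 1) := by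
  have h1 := (mul_log_le_densityDist hρ hz hw hc hψ hlip hlow).trans hD
  have hp := hψ z hz
  rw [← le_div_iff₀' hc, Real.log_le_iff_le_exp (by positivity)] at h1
  have : ‖w - z‖ / ψ z ≤ Real.exp (D / c) - 1 := by linarith
  rwa [div_le_iff₀' hp] at this

lemma tendsto_densityDist_nhds (hρ : IsConformalDensity S ρ) (hz : z ∈ S) :
    Tendsto (fun w => densityDist S ρ w z) (nhds z) (nhds 0) := by
  obtain ⟨r, hr, hball⟩ := Metric.nhds_basis_ball.mem_iff.1
    (inter_mem (hρ.isOpen.mem_nhds hz)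
      ((hρ.continuousOn.continuousAt (hρ.isOpen.mem_nhds hz)).eventually
        (Iio_mem_nhds (lt_add_one (ρ z)))))
  have h1 : Tendsto (fun w => (ρ z + 1) * ‖z - w‖) (nhds z) (nhds 0) := by
    have : ContinuousAt (fun w => (ρ z + 1) * ‖z - w‖) z := by fun_prop
    simpa [ContinuousAt] using this
  refine squeeze_zero' (Eventually.of_forall fun w => densityDist_nonneg hρ.pos) ?_ h1
  filter_upwards [ball_mem_nhds z hr] with w hw
  refine densityDist_le_mul_of_segment hρ.pos fun s hs => ?_
  have : w + s * (z - w) ∈ ball z r := by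
    have h2 : ‖w + s * (z - w) - z‖ = (1 - s) * ‖w - z‖ := by
      rw [show w + s * (z - w) - z = ((1 - s : ℝ) : ℂ) * (w - z) by push_cast; ring, norm_mul,
        norm_real, Real.norm_of_nonneg (by linarith [hs.2])]
    rw [mem_ball_iff_norm] at hw ⊢
    rw [h2]
    nlinarith [hs.1, hs.2, norm_nonneg (w - z)]
  exact ⟨(hball this).1, le_of_lt (hball this).2⟩

/-- A curve can be parametrized proportionally to its length. -/
lemma IsC1CurveIn.exists_lipschitz_param (h : IsC1CurveIn S x y γ) (hρ : IsConformalDensity S ρ)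
    {D : ℝ} (hD : 0 < D) :
    ∃ g : ℝ → ℂ, g 0 = x ∧ g D = y ∧ (∀ τ ∈ Icc 0 D, g τ ∈ S) ∧
      ∀ τ ∈ Icc 0 D, ∀ τ' ∈ Icc 0 D,
        densityDist S ρ (g τ) (g τ') ≤ curveLen ρ γ / D * |τ - τ'| := by
  set ℓ : ℝ → ℝ := fun s => ∫ t in (0:ℝ)..s, ρ (γ t) * ‖deriv γ t‖ with hℓ
  have hℓ0 : ℓ 0 = 0 := by simp [hℓ]
  have hℓ1 : ℓ 1 = curveLen ρ γ := rfl
  have hcont : ContinuousOn ℓ (Icc 0 1) := by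
    have := intervalIntegral.continuousOn_primitive_interval' (a := 0)
      (h.intervalIntegrable hρ.continuousOn le_rfl zero_le_one le_rfl) (by simp)
    rwa [uIcc_of_le zero_le_one] at this
  have hL := h.curveLen_nonneg hρ.pos
  have key : ∀ τ, ∃ σ, τ ∈ Icc 0 D → σ ∈ Icc (0:ℝ) 1 ∧ ℓ σ = curveLen ρ γ / D * τ ∧
      (τ = 0 → σ = 0) ∧ (τ = D → σ = 1) := by
    intro τ
    by_cases h0 : τ = 0
    · exact ⟨0, fun _ => ⟨by simp, by simp [hℓ0, h0], fun _ => rfl, fun h => by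
        linarith [h0.symm.trans h]⟩⟩
    by_cases h1 : τ = D
    · refine ⟨1, fun _ => ⟨by simp, by rw [hℓ1, h1]; field_simp, fun h => absurd h h0,
        fun _ => rfl⟩⟩
    by_cases hτ : τ ∈ Icc 0 D
    · have : curveLen ρ γ / D * τ ∈ Icc (ℓ 0) (ℓ 1) := by
        rw [hℓ0, hℓ1]
        refine ⟨by have := hτ.1; positivity, ?_⟩
        rw [div_mul_eq_mul_div, div_le_iff₀ hD]
        exact mul_le_mul_of_nonneg_left hτ.2 hL
      obtain ⟨σ, hσ, hσ'⟩ := intermediate_value_Icc zero_le_one hcont this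
      exact ⟨σ, fun _ => ⟨hσ, hσ', fun h => absurd h h0, fun h => absurd h h1⟩⟩
    · exact ⟨0, fun h => absurd h hτ⟩
  choose σ hσ using key
  refine ⟨fun τ => γ (σ τ), ?_, ?_, fun τ hτ => h.2.2.2 _ (hσ τ hτ).1, ?_⟩
  · dsimp only
    rw [(hσ 0 ⟨le_rfl, hD.le⟩).2.2.1 rfl, h.2.1]
  · dsimp only
    rw [(hσ D ⟨hD.le, le_rfl⟩).2.2.2 rfl, h.2.2.1]
  · have main : ∀ τ ∈ Icc 0 D, ∀ τ' ∈ Icc 0 D, σ τ ≤ σ τ' →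
        densityDist S ρ (γ (σ τ)) (γ (σ τ')) ≤ curveLen ρ γ / D * |τ - τ'| := by
      intro τ hτ τ' hτ' hle
      obtain ⟨h1, h2, -⟩ := hσ τ hτ
      obtain ⟨h3, h4, -⟩ := hσ τ' hτ'
      refine (h.densityDist_le_integral hρ.pos h1.1 hle h3.2).trans ?_
      have h5 := intervalIntegral.integral_interval_sub_left
        (h.intervalIntegrable hρ.continuousOn le_rfl h3.1 h3.2)
        (h.intervalIntegrable hρ.continuousOn le_rfl h1.1 h1.2)
      rw [← h5]
      change ℓ (σ τ') - ℓ (σ τ) ≤ _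
      rw [h2, h4, ← mul_sub, abs_sub_comm]
      exact mul_le_mul_of_nonneg_left (le_abs_self _) (by positivity)
    intro τ hτ τ' hτ'
    rcases le_total (σ τ) (σ τ') with hle | hle
    · exact main τ hτ τ' hτ' hle
    · rw [densityDist_comm hρ (h.2.2.2 _ (hσ τ hτ).1) (h.2.2.2 _ (hσ τ' hτ').1), abs_sub_comm]
      exact main τ' hτ' τ hτ hle

/-- A map which does not increase distances and realizes the distance of its endpoints is a
geodesic. -/
lemma isGeodesicIn_of_le (hρ : IsConformalDensity S ρ) {g : ℝ → ℂ}
    (h0 : g 0 = x) (h1 : g (densityDist S ρ x y) = y)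
    (hS : ∀ t ∈ Icc 0 (densityDist S ρ x y), g t ∈ S)
    (hle : ∀ s ∈ Icc 0 (densityDist S ρ x y), ∀ t ∈ Icc 0 (densityDist S ρ x y),
      densityDist S ρ (g s) (g t) ≤ |s - t|) :
    IsGeodesicIn S (densityDist S ρ) g x y := by
  set D := densityDist S ρ x y with hD
  have hD0 : 0 ≤ D := densityDist_nonneg hρ.pos
  have hm0 : (0:ℝ) ∈ Icc 0 D := ⟨le_rfl, hD0⟩
  have hmD : D ∈ Icc 0 D := ⟨hD0, le_rfl⟩
  refine ⟨h0, h1, hS, ?_⟩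
  have main : ∀ s ∈ Icc 0 D, ∀ t ∈ Icc 0 D, s ≤ t → densityDist S ρ (g s) (g t) = |s - t| := by
    intro s hs t ht hst
    refine le_antisymm (hle s hs t ht) ?_
    have e1 := hle 0 hm0 s hs
    have e2 := hle t ht D hmD
    have e3 := densityDist_triangle hρ (hS 0 hm0) (hS s hs) (hS D hmD)
    have e4 := densityDist_triangle hρ (hS s hs) (hS t ht) (hS D hmD)
    rw [abs_sub_comm, abs_of_nonneg (by linarith [hs.1])] at e1
    rw [abs_sub_comm, abs_of_nonneg (by linarith [ht.2])] at e2
    rw [abs_sub_comm, abs_of_nonneg (by linarith)]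
    rw [h0, h1, ← hD] at e3
    rw [h1] at e2 e4
    rw [h0] at e1
    linarith
  intro s hs t ht
  rcases le_total s t with h | h
  · exact main s hs t ht h
  · rw [densityDist_comm hρ (hS s hs) (hS t ht), abs_sub_comm]
    exact main t ht s hs h

/-- Existence of geodesics when bounded balls are relatively compact. -/
theorem exists_isGeodesicIn (hρ : IsConformalDensity S ρ) (hx : x ∈ S) (hy : y ∈ S)
    (hD : 0 < densityDist S ρ x y) {K : Set ℂ} (hK : IsCompact K) (hKS : K ⊆ S)
    (hball : ∀ w ∈ S, densityDist S ρ x w ≤ densityDist S ρ x y + 1 → w ∈ K) :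
    ∃ g, IsGeodesicIn S (densityDist S ρ) g x y := by
  set D := densityDist S ρ x y with hD_def
  have key : ∀ n : ℕ, ∃ g : ℝ → ℂ, g 0 = x ∧ g D = y ∧ (∀ τ ∈ Icc 0 D, g τ ∈ K) ∧
      ∀ τ ∈ Icc 0 D, ∀ τ' ∈ Icc 0 D,
        densityDist S ρ (g τ) (g τ') ≤ (D + 1 / ((n : ℝ) + 1)) / D * |τ - τ'| := by
    intro n
    have hn : (0:ℝ) < 1 / ((n : ℝ) + 1) := by positivity
    have hn1 : 1 / ((n : ℝ) + 1) ≤ 1 := by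
      rw [div_le_one (by positivity)]; linarith [n.cast_nonneg (α := ℝ)]
    obtain ⟨γ, h1, h2⟩ := exists_curveLen_lt hρ hx hy (lt_add_of_pos_right _ hn)
    obtain ⟨g, g0, gD, gS, gl⟩ := h1.exists_lipschitz_param hρ hD
    refine ⟨g, g0, gD, fun τ hτ => hball _ (gS τ hτ) ?_, fun τ hτ τ' hτ' =>
      (gl τ hτ τ' hτ').trans (by gcongr)⟩
    have := gl 0 ⟨le_rfl, hD.le⟩ τ hτ
    rw [g0, zero_sub, abs_neg, abs_of_nonneg hτ.1] at this
    refine this.trans ?_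
    calc curveLen ρ γ / D * τ ≤ curveLen ρ γ / D * D := by
          have := h1.curveLen_nonneg hρ.pos
          have := hτ.2
          gcongr
      _ = curveLen ρ γ := by field_simp
      _ ≤ D + 1 := by linarith
  choose g g0 gD gK gl using key
  let U : Ultrafilter ℕ := Ultrafilter.of atTop
  have hU : (U : Filter ℕ) ≤ atTop := Ultrafilter.of_le _
  have hlim : ∀ τ, ∃ p, τ ∈ Icc 0 D → p ∈ K ∧ Tendsto (fun n => g n τ) U (nhds p) := by
    intro τ
    by_cases hτ : τ ∈ Icc 0 D
    · obtain ⟨p, hp, hp'⟩ := hK.ultrafilter_le_nhds (U.map fun n => g n τ)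
        (tendsto_principal.2 (Eventually.of_forall fun n => gK n τ hτ))
      exact ⟨p, fun _ => ⟨hp, hp'⟩⟩
    · exact ⟨0, fun h => absurd h hτ⟩
  choose G hG using hlim
  have hm0 : (0:ℝ) ∈ Icc 0 D := ⟨le_rfl, hD.le⟩
  have hmD : D ∈ Icc 0 D := ⟨hD.le, le_rfl⟩
  refine ⟨G, isGeodesicIn_of_le hρ ?_ ?_ (fun t ht => hKS (hG t ht).1) fun s hs t ht => ?_⟩
  · exact tendsto_nhds_unique (hG 0 hm0).2 (by simp only [g0]; exact tendsto_const_nhds)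
  · exact tendsto_nhds_unique (hG D hmD).2 (by simp only [gD]; exact tendsto_const_nhds)
  · obtain ⟨hs1, hs2⟩ := hG s hs
    obtain ⟨ht1, ht2⟩ := hG t ht
    have e1 : Tendsto (fun n => densityDist S ρ (g n s) (G s)) U (nhds 0) :=
      (tendsto_densityDist_nhds hρ (hKS hs1)).comp hs2
    have e2 : Tendsto (fun n => densityDist S ρ (g n t) (G t)) U (nhds 0) :=
      (tendsto_densityDist_nhds hρ (hKS ht1)).comp ht2
    have e3 : Tendsto (fun n : ℕ => (D + 1 / ((n : ℝ) + 1)) / D * |s - t|) U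
        (nhds ((D + 0) / D * |s - t|)) :=
      (((tendsto_const_nhds.add tendsto_one_div_add_atTop_nhds_zero_nat).div_const D).mul_const
        _).mono_left hU
    have e4 := (e1.add e3).add e2
    simp only [add_zero, zero_add, div_self hD.ne', one_mul] at e4
    refine ge_of_tendsto' e4 fun n => ?_
    have hns := hKS (gK n s hs)
    have hnt := hKS (gK n t ht)
    have t1 := densityDist_triangle hρ (hKS hs1) hns (hKS ht1)
    have t2 := densityDist_triangle hρ hns hnt (hKS ht1)
    have t3 := gl n s hs t ht
    rw [densityDist_comm hρ (hKS hs1) hns] at t1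
    linarith

/-- A conformal density on a domain symmetric under complex conjugation. -/
structure IsConjInvariant (S : Set ℂ) (ρ : ℂ → ℝ) : Prop where
  conj_mem : ∀ z ∈ S, (starRingEnd ℂ) z ∈ S
  apply_conj : ∀ z ∈ S, ρ ((starRingEnd ℂ) z) = ρ z

lemma densityDist_conj_le (hρ : IsConformalDensity S ρ) (hs : IsConjInvariant S ρ) (hz : z ∈ S)
    (hw : w ∈ S) :
    densityDist S ρ ((starRingEnd ℂ) z) ((starRingEnd ℂ) w) ≤ densityDist S ρ z w := by
  refine le_of_forall_gt fun L hL => ?_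
  obtain ⟨γ, h1, h2⟩ := exists_curveLen_lt hρ hz hw hL
  have h3 : IsC1CurveIn S ((starRingEnd ℂ) z) ((starRingEnd ℂ) w)
      (fun s => (starRingEnd ℂ) (γ s)) := by
    refine ⟨conjCLE.contDiff.comp_contDiffOn h1.1, by simp [h1.2.1], by simp [h1.2.2.1],
      fun s hs' => hs.conj_mem _ (h1.2.2.2 s hs')⟩
  refine (densityDist_le hρ.pos h3).trans_lt (lt_of_eq_of_lt ?_ h2)
  refine intervalIntegral.integral_congr_uIoo fun s hs' => ?_
  rw [uIoo_of_le zero_le_one] at hs'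
  have h4 := conjCLE.toContinuousLinearMap.hasFDerivAt.comp_hasDerivAt s (h1.hasDerivAt hs')
  have h5 : deriv (fun s => (starRingEnd ℂ) (γ s)) s =
      (starRingEnd ℂ) (derivWithin γ (Icc 0 1) s) := h4.deriv
  simp only [h5, norm_conj, hs.apply_conj _ (h1.2.2.2 s (Ioo_subset_Icc_self hs')),
    deriv_eq_derivWithin_Icc hs']

lemma densityDist_conj (hρ : IsConformalDensity S ρ) (hs : IsConjInvariant S ρ) (hz : z ∈ S)
    (hw : w ∈ S) :
    densityDist S ρ ((starRingEnd ℂ) z) ((starRingEnd ℂ) w) = densityDist S ρ z w := by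
  refine le_antisymm (densityDist_conj_le hρ hs hz hw) ?_
  simpa using densityDist_conj_le hρ hs (hs.conj_mem z hz) (hs.conj_mem w hw)

/-- A curve joining the two closed half planes crosses the real axis. -/
lemma exists_real_crossing (hρ : IsConformalDensity S ρ) (hz : z ∈ S) (hw : w ∈ S)
    (hzi : 0 ≤ z.im) (hwi : w.im ≤ 0) {ε : ℝ} (hε : 0 < ε) :
    ∃ q ∈ S, q.im = 0 ∧
      densityDist S ρ z q + densityDist S ρ q w < densityDist S ρ z w + ε := by
  obtain ⟨γ, h1, h2⟩ := exists_curveLen_lt hρ hz hw (lt_add_of_pos_right _ hε)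
  have hc : ContinuousOn (fun s => (γ s).im) (Icc 0 1) :=
    continuous_im.comp_continuousOn h1.1.continuousOn
  obtain ⟨s, hs, hs0⟩ : (0:ℝ) ∈ (fun s => (γ s).im) '' Icc 0 1 := by
    refine intermediate_value_Icc' zero_le_one hc ⟨?_, ?_⟩
    · simpa [h1.2.2.1] using hwi
    · simpa [h1.2.1] using hzi
  refine ⟨γ s, h1.2.2.2 s hs, hs0, lt_of_le_of_lt ?_ h2⟩
  have e1 := h1.densityDist_le_integral hρ.pos le_rfl hs.1 hs.2
  have e2 := h1.densityDist_le_integral hρ.pos hs.1 hs.2 le_rfl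
  rw [h1.2.1] at e1
  rw [h1.2.2.1] at e2
  rw [curveLen, ← intervalIntegral.integral_add_adjacent_intervals
    (h1.intervalIntegrable hρ.continuousOn le_rfl hs.1 hs.2)
    (h1.intervalIntegrable hρ.continuousOn hs.1 hs.2 le_rfl)]
  exact add_le_add e1 e2

/-- Folding the plane onto the closed upper half plane. -/
def upperFold (z : ℂ) : ℂ := if 0 ≤ z.im then z else (starRingEnd ℂ) z

lemma upperFold_im_nonneg (z : ℂ) : 0 ≤ (upperFold z).im := by
  unfold upperFold
  split_ifs with h
  · exact h
  · simp; linarith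

lemma IsConjInvariant.upperFold_mem (hs : IsConjInvariant S ρ) (hz : z ∈ S) :
    upperFold z ∈ S := by
  unfold upperFold
  split_ifs with h
  exacts [hz, hs.conj_mem z hz]

lemma densityDist_upperFold_le (hρ : IsConformalDensity S ρ) (hs : IsConjInvariant S ρ)
    (hz : z ∈ S) (hw : w ∈ S) :
    densityDist S ρ (upperFold z) (upperFold w) ≤ densityDist S ρ z w := by
  have key : ∀ z ∈ S, ∀ w ∈ S, 0 ≤ z.im → w.im ≤ 0 →
      densityDist S ρ z ((starRingEnd ℂ) w) ≤ densityDist S ρ z w := by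
    intro z hz w hw hzi hwi
    refine le_of_forall_pos_le_add fun ε hε => ?_
    obtain ⟨q, hq, hq0, hlt⟩ := exists_real_crossing hρ hz hw hzi hwi hε
    have h1 := densityDist_conj hρ hs hq hw
    rw [conj_eq_iff_im.2 hq0] at h1
    linarith [densityDist_triangle hρ hz hq (hs.conj_mem w hw)]
  unfold upperFold
  split_ifs with h1 h2 h2
  · exact le_rfl
  · exact key z hz w hw h1 (not_le.1 h2).le
  · rw [densityDist_comm hρ (hs.conj_mem z hz) hw, densityDist_comm hρ hz hw]
    exact key w hw z hz h2 (not_le.1 h1).le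
  · exact densityDist_conj_le hρ hs hz hw

lemma IsGeodesicIn.upperFold (hρ : IsConformalDensity S ρ) (hs : IsConjInvariant S ρ)
    {g : ℝ → ℂ} (hg : IsGeodesicIn S (densityDist S ρ) g x y) (hx : x.im = 0) (hy : y.im = 0) :
    IsGeodesicIn S (densityDist S ρ) (fun s => upperFold (g s)) x y := by
  obtain ⟨h0, h1, h2, h3⟩ := hg
  refine isGeodesicIn_of_le hρ (by simp [h0, _root_.upperFold, hx])
    (by simp [h1, _root_.upperFold, hy]) (fun t ht => hs.upperFold_mem (h2 t ht))
    fun s hs' t ht => ?_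
  rw [← h3 s hs' t ht]
  exact densityDist_upperFold_le hρ hs (h2 s hs') (h2 t ht)

lemma IsGeodesicIn.conj (hρ : IsConformalDensity S ρ) (hs : IsConjInvariant S ρ)
    {g : ℝ → ℂ} (hg : IsGeodesicIn S (densityDist S ρ) g x y) (hx : x.im = 0) (hy : y.im = 0) :
    IsGeodesicIn S (densityDist S ρ) (fun s => (starRingEnd ℂ) (g s)) x y := by
  obtain ⟨h0, h1, h2, h3⟩ := hg
  refine ⟨by simp [h0, conj_eq_iff_im.2 hx], by simp [h1, conj_eq_iff_im.2 hy],
    fun t ht => hs.conj_mem _ (h2 t ht), fun s hs' t ht => ?_⟩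
  rw [densityDist_conj hρ hs (h2 s hs') (h2 t ht), h3 s hs' t ht]

lemma IsGeodesicIn.continuousOn (hρ : IsConformalDensity S ρ) {c : ℝ} (hc : 0 < c) {ψ : ℂ → ℝ}
    (hψ : ∀ z ∈ S, 0 < ψ z) (hlip : ∀ z w, ψ z ≤ ψ w + ‖z - w‖) (hlow : ∀ z ∈ S, c / ψ z ≤ ρ z)
    {g : ℝ → ℂ} (hg : IsGeodesicIn S (densityDist S ρ) g x y) :
    ContinuousOn g (Icc 0 (densityDist S ρ x y)) := by
  intro s hs
  have h1 : Tendsto (fun τ => ψ (g s) * (Real.exp (|s - τ| / c) - 1)) (nhds s) (nhds 0) := by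
    have : ContinuousAt (fun τ => ψ (g s) * (Real.exp (|s - τ| / c) - 1)) s := by fun_prop
    simpa [ContinuousAt] using this
  rw [ContinuousWithinAt, tendsto_iff_norm_sub_tendsto_zero]
  refine squeeze_zero' (Eventually.of_forall fun _ => norm_nonneg _) ?_
    (h1.mono_left nhdsWithin_le_nhds)
  filter_upwards [self_mem_nhdsWithin] with τ hτ
  exact norm_sub_le_of_densityDist_le hρ (hg.2.2.1 s hs) (hg.2.2.1 τ hτ) hc hψ hlip hlow
    (hg.2.2.2 s hs τ hτ).le

/-- A geodesic along which `ψ ≤ A` makes at most linear progress. -/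
lemma IsGeodesicIn.norm_sub_le (hρ : IsConformalDensity S ρ) {c : ℝ} (hc : 0 < c) {ψ : ℂ → ℝ}
    (hψ : ∀ z ∈ S, 0 < ψ z) (hlip : ∀ z w, ψ z ≤ ψ w + ‖z - w‖) (hlow : ∀ z ∈ S, c / ψ z ≤ ρ z)
    {g : ℝ → ℂ} (hg : IsGeodesicIn S (densityDist S ρ) g x y) {A : ℝ}
    (hA : ∀ s ∈ Icc 0 (densityDist S ρ x y), ψ (g s) ≤ A) :
    ‖y - x‖ ≤ (densityDist S ρ x y / c + 1) * (2 * A) := by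
  set D := densityDist S ρ x y with hD_def
  have hD : 0 ≤ D := densityDist_nonneg hρ.pos
  set N := ⌊D / c⌋₊ + 1 with hN
  have hN0 : (0:ℝ) < N := by positivity
  have hNle : (N:ℝ) ≤ D / c + 1 := by
    rw [hN]; push_cast
    linarith [Nat.floor_le (show 0 ≤ D / c by positivity)]
  have hstep : D / N ≤ c := by
    rw [div_le_iff₀ hN0, mul_comm, ← div_le_iff₀ hc, hN]
    exact_mod_cast (Nat.lt_floor_add_one (D / c)).le
  have hA0 : 0 ≤ A := by
    have h0 : (0:ℝ) ∈ Icc 0 D := ⟨le_rfl, hD⟩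
    exact (hψ _ (hg.2.2.1 0 h0)).le.trans (hA 0 h0)
  have hmem : ∀ k : ℕ, k ≤ N → k * (D / N) ∈ Icc 0 D := by
    intro k hk
    refine ⟨by positivity, ?_⟩
    calc k * (D / N) ≤ N * (D / N) := by gcongr
      _ = D := by field_simp
  have hind : ∀ k : ℕ, k ≤ N → ‖g (k * (D / N)) - x‖ ≤ k * (2 * A) := by
    intro k
    induction k with
    | zero => intro _; simp [hg.1]
    | succ k ih =>
      intro hk
      have h1 := hmem k (by omega)
      have h2 := hmem (k + 1) hk
      have h3 : densityDist S ρ (g (k * (D / N))) (g ((k + 1 : ℕ) * (D / N))) ≤ c := by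
        rw [hg.2.2.2 _ h1 _ h2]
        push_cast
        rw [show (k:ℝ) * (D / N) - (k + 1) * (D / N) = -(D / N) by ring, abs_neg,
          abs_of_nonneg (by positivity)]
        exact hstep
      have h4 := norm_sub_le_of_densityDist_le hρ (hg.2.2.1 _ h1) (hg.2.2.1 _ h2) hc hψ hlip
        hlow h3
      rw [div_self hc.ne'] at h4
      have h5 : ψ (g (k * (D / N))) * (Real.exp 1 - 1) ≤ A * 2 := by
        have := hA _ h1
        have := Real.exp_one_lt_d9
        have := Real.add_one_le_exp 1
        gcongr <;> linarith
      have h6 := norm_sub_le_norm_sub_add_norm_sub (g ((k + 1 : ℕ) * (D / N)))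
        (g (k * (D / N))) x
      have h7 := ih (by omega)
      push_cast at *
      linarith
  have h := hind N le_rfl
  rw [show (N:ℝ) * (D / N) = D by field_simp, hg.2.1] at h
  refine h.trans ?_
  gcongr

lemma exists_nat_mul_gt_log {a b e t g : ℝ} (ht : 0 < t) (hg : 0 < g) (he : 0 < e) :
    ∃ M : ℕ, 0 < M ∧ a * Real.log ((g + M * t) / g) + b < e * (M * t) := by
  have h1 : Tendsto (fun M : ℕ => (g + M * t) / g) atTop atTop := by
    refine Tendsto.atTop_div_const hg (tendsto_atTop_add_const_left _ _ ?_)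
    exact tendsto_natCast_atTop_atTop.atTop_mul_const ht
  have h2 : (fun x : ℝ => a * Real.log x + b) =o[atTop] fun x => x :=
    (Real.isLittleO_log_id_atTop.const_mul_left a).add
      (Asymptotics.isLittleO_const_id_atTop b)
  have h3 := (h2.comp_tendsto h1).bound (show 0 < e * g / 2 by positivity)
  have h4 := h1.eventually_gt_atTop 2
  obtain ⟨M, hM3, hM4, hM0⟩ := (h3.and (h4.and (eventually_gt_atTop 0))).exists
  refine ⟨M, hM0, ?_⟩
  simp only [Function.comp_apply] at hM3
  rw [Real.norm_of_nonneg (show 0 ≤ (g + M * t) / g by linarith)] at hM3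
  have h5 := (le_abs_self _).trans hM3
  have h6 : e * g / 2 * ((g + M * t) / g) = e * (g + M * t) / 2 := by field_simp
  have h7 : g < M * t := by
    rw [lt_div_iff₀ hg] at hM4; linarith
  rw [h6] at h5
  nlinarith

lemma densityDist_vertical_le (hρ : IsConformalDensity S ρ) {C g H : ℝ} (hg : 0 < g)
    (hH : 0 < H) (hS : ∀ s : ℝ, z + s * I ∈ S) (hup : ∀ s : ℝ, ρ (z + s * I) ≤ C / (g + |s|)) :
    densityDist S ρ z (z + H * I) ≤ C * Real.log ((g + H) / g) := by
  have hseg : ∀ s : ℝ, z + s * (z + H * I - z) = z + (s * H : ℝ) * I := fun s => by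
    push_cast; ring
  refine (densityDist_le_segment hρ.pos fun s _ => by rw [hseg]; exact hS _).trans ?_
  have hpos : ∀ s ∈ Icc (0:ℝ) 1, 0 < g + s * H := fun s hs => by
    have := mul_nonneg hs.1 hH.le
    linarith
  have hcont : ContinuousOn (fun s : ℝ => C * (H / (g + s * H))) (Icc 0 1) :=
    continuousOn_const.mul (continuousOn_const.div (by fun_prop) fun s hs => (hpos s hs).ne')
  have hint : ∫ s in (0:ℝ)..1, C * (H / (g + s * H)) = C * Real.log ((g + H) / g) := by
    refine (intervalIntegral.integral_eq_sub_of_hasDerivAt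
      (f := fun s => C * Real.log (g + s * H)) (fun s hs => ?_) ?_).trans ?_
    · rw [uIcc_of_le zero_le_one] at hs
      have h1 : HasDerivAt (fun s : ℝ => g + s * H) H s := by
        simpa using ((hasDerivAt_id s).mul_const H).const_add g
      exact (h1.log (hpos s hs).ne').const_mul C
    · apply ContinuousOn.intervalIntegrable
      rwa [uIcc_of_le zero_le_one]
    · simp only [one_mul, zero_mul, add_zero]
      rw [Real.log_div (by positivity) hg.ne', mul_sub]
  rw [← hint]
  have hn : ‖z + H * I - z‖ = H := by simp [abs_of_pos hH]
  refine intervalIntegral.integral_mono_on zero_le_one ?_ ?_ fun s hs => ?_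
  · apply Continuous.intervalIntegrable
    refine Continuous.mul (hρ.continuousOn.comp_continuous (by fun_prop) fun s => ?_)
      continuous_const
    rw [hseg]; exact hS _
  · apply ContinuousOn.intervalIntegrable
    rwa [uIcc_of_le zero_le_one]
  · rw [hseg, hn]
    have h1 := hup (s * H)
    rw [abs_of_nonneg (mul_nonneg hs.1 hH.le)] at h1
    calc ρ (z + (s * H : ℝ) * I) * H ≤ C / (g + s * H) * H := by gcongr
      _ = _ := by ring

lemma densityDist_horizontal_le (hρ : IsConformalDensity S ρ) {C g H : ℝ} (hg : 0 < g)
    (hH : 0 < H) (hS : ∀ z : ℂ, z.im ≠ 0 → z ∈ S)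
    (hx : ∀ s : ℝ, z + s * I ∈ S) (hy : ∀ s : ℝ, z + H + s * I ∈ S)
    (hz : z.im = 0)
    (hxup : ∀ s : ℝ, ρ (z + s * I) ≤ C / (g + |s|))
    (hyup : ∀ s : ℝ, ρ (z + H + s * I) ≤ C / (g + |s|))
    (hup : ∀ z : ℂ, z.im ≠ 0 → ρ z ≤ C / |z.im|) :
    densityDist S ρ z (z + H) ≤ 2 * C * Real.log ((g + H) / g) + C := by
  have h1 := densityDist_vertical_le hρ hg hH hx hxup
  have h2 := densityDist_vertical_le hρ hg hH hy hyup
  have h3 : densityDist S ρ (z + H * I) (z + H + H * I) ≤ C := by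
    refine (densityDist_le_mul_of_segment hρ.pos (B := C / H) fun s _ => ?_).trans (le_of_eq ?_)
    · have him : (z + H * I + s * (z + H + H * I - (z + H * I))).im = H := by simp [hz]
      refine ⟨hS _ (by rw [him]; exact hH.ne'), ?_⟩
      have := hup _ (by rw [him]; exact hH.ne')
      rwa [him, abs_of_pos hH] at this
    · have : z + H + H * I - (z + H * I) = H := by ring
      rw [this, norm_real, Real.norm_of_nonneg hH.le]
      field_simp
  have hzS : z ∈ S := by simpa using hx 0
  have hwS : z + H ∈ S := by simpa using hy 0
  have h4 := densityDist_triangle hρ hzS (hx H) hwS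
  have h5 := densityDist_triangle hρ (hx H) (hy H) hwS
  rw [densityDist_comm hρ hwS (hy H)] at h2
  linarith

/-- A conformal density, symmetric about the real axis and with the geometry of a Denjoy domain that
is periodic to the right, is not Gromov hyperbolic. -/
theorem not_isGromovHyperbolic_of_periodic (hρ : IsConformalDensity S ρ)
    (hs : IsConjInvariant S ρ) {t c g C m : ℝ} (ht : 0 < t) (hc : 0 < c) (hg : 0 < g)
    (hm : 0 ≤ m) {ψ : ℂ → ℝ} (hlip : ∀ z w, ψ z ≤ ψ w + ‖z - w‖) (hψt : ∀ z, t ≤ ψ z)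
    (hψ0 : ∀ q : ℂ, q.im = 0 → 0 ≤ q.re → ψ q = t) (hlow : ∀ z ∈ S, c / ψ z ≤ ρ z)
    (hS : ∀ z : ℂ, z.im ≠ 0 → z ∈ S)
    (hxS : ∀ n : ℕ, ∀ s : ℝ, ((m + n * t : ℝ) : ℂ) + s * I ∈ S)
    (hxup : ∀ n : ℕ, ∀ s : ℝ, ρ (((m + n * t : ℝ) : ℂ) + s * I) ≤ C / (g + |s|))
    (hup : ∀ z : ℂ, z.im ≠ 0 → ρ z ≤ C / |z.im|)
    (hcpt : ∀ x ∈ S, ∀ R : ℝ, ∃ K ⊆ S, IsCompact K ∧ ∀ w ∈ S, densityDist S ρ x w ≤ R → w ∈ K) :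
    ¬ IsGromovHyperbolic S (densityDist S ρ) := by
  rintro ⟨δ, hδ, hthin⟩
  have hψ : ∀ z ∈ S, 0 < ψ z := fun z _ => ht.trans_le (hψt z)
  set B := Real.exp ((δ + 1) / c) with hB_def
  have hB : 1 ≤ B := Real.one_le_exp (by positivity)
  set A := t * (B + 1) with hA_def
  have hA : 0 < A := by positivity
  obtain ⟨M, hM0, hM⟩ := exists_nat_mul_gt_log (a := 2 * C / c * (2 * A))
    (b := (C / c + 1) * (2 * A)) (e := 1) ht hg one_pos
  have hH : 0 < M * t := by positivity
  set D' := 2 * C * Real.log ((g + M * t) / g) + C with hD'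
  obtain ⟨n, hn⟩ := exists_nat_ge ((t * Real.exp (D' / c) + A * B) / t)
  rw [div_le_iff₀ ht] at hn
  set x : ℂ := ((m + n * t : ℝ) : ℂ) with hx_def
  set y : ℂ := ((m + (n + M : ℕ) * t : ℝ) : ℂ) with hy_def
  have hxy : y = x + (M * t : ℝ) := by rw [hx_def, hy_def]; push_cast; ring
  have hx : x ∈ S := by simpa [hx_def] using hxS n 0
  have hy : y ∈ S := by simpa [hy_def] using hxS (n + M) 0
  have hxi : x.im = 0 := ofReal_im _
  have hyi : y.im = 0 := ofReal_im _
  have hψx : ψ x = t := hψ0 x hxi (by rw [hx_def, ofReal_re]; positivity)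
  have hnorm : ‖y - x‖ = M * t := by
    rw [hxy, add_sub_cancel_left, norm_real, Real.norm_of_nonneg hH.le]
  have hDle : densityDist S ρ x y ≤ D' := by
    rw [hxy]
    refine densityDist_horizontal_le hρ hg hH hS (hxS n) ?_ hxi (hxup n) ?_ hup
    · rw [← hxy]; exact hxS (n + M)
    · rw [← hxy]; exact hxup (n + M)
  have hD0 : 0 < densityDist S ρ x y := by
    refine lt_of_lt_of_le ?_ (mul_log_le_densityDist hρ hx hy hc hψ hlip hlow)
    rw [hnorm, hψx]
    refine mul_pos hc (Real.log_pos ?_)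
    have : 0 < M * t / t := by positivity
    linarith
  obtain ⟨K, hKS, hK, hball⟩ := hcpt x hx (densityDist S ρ x y + 1)
  obtain ⟨g₀, hg₀⟩ := exists_isGeodesicIn hρ hx hy hD0 hK hKS hball
  obtain ⟨γ, hγ, hγi⟩ : ∃ γ, IsGeodesicIn S (densityDist S ρ) γ x y ∧ ∀ s, 0 ≤ (γ s).im :=
    ⟨_, hg₀.upperFold hρ hs hxi hyi, fun s => upperFold_im_nonneg _⟩
  have hhigh : ∃ s ∈ Icc 0 (densityDist S ρ x y), A ≤ ψ (γ s) := by
    by_contra! hcon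
    have h1 := hγ.norm_sub_le hρ hc hψ hlip hlow fun s hs => (hcon s hs).le
    rw [hnorm] at h1
    have h2 : (densityDist S ρ x y / c + 1) * (2 * A) ≤ (D' / c + 1) * (2 * A) := by gcongr
    have h3 : (D' / c + 1) * (2 * A) = 2 * C / c * (2 * A) * Real.log ((g + M * t) / g) +
        (C / c + 1) * (2 * A) := by rw [hD']; ring
    linarith
  obtain ⟨s, hs', hsA⟩ := hhigh
  have hψc : Continuous ψ := by
    refine (LipschitzWith.of_le_add fun z w => ?_ : LipschitzWith 1 ψ).continuous
    rw [dist_eq_norm]; exact hlip z w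
  have hcont : ContinuousOn (fun s => ψ (γ s)) (Icc 0 s) :=
    hψc.comp_continuousOn ((hγ.continuousOn hρ hc hψ hlip hlow).mono
      (Icc_subset_Icc le_rfl hs'.2))
  obtain ⟨τ, hτ, hτA⟩ : A ∈ (fun s => ψ (γ s)) '' Icc 0 s := by
    refine intermediate_value_Icc hs'.1 hcont ⟨?_, hsA⟩
    simp only [hγ.1, hψx, hA_def]
    nlinarith
  have hτ' : τ ∈ Icc 0 (densityDist S ρ x y) := ⟨hτ.1, hτ.2.trans hs'.2⟩
  simp only at hτA
  set w := γ τ with hw_def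
  have hw : w ∈ S := hγ.2.2.1 τ hτ'
  have hwx : ‖w - x‖ ≤ t * (Real.exp (D' / c) - 1) := by
    rw [← hψx]
    refine norm_sub_le_of_densityDist_le hρ hx hw hc hψ hlip hlow ?_
    have := hγ.2.2.2 0 ⟨le_rfl, hD0.le⟩ τ hτ'
    rw [hγ.1, zero_sub, abs_neg, abs_of_nonneg hτ.1] at this
    rw [this]
    exact hτ'.2.trans hDle
  have hyy : densityDist S ρ y y = 0 := densityDist_self hρ.pos hy
  have hyconst : IsGeodesicIn S (densityDist S ρ) (fun _ => y) y y := by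
    refine ⟨rfl, rfl, fun _ _ => hy, fun a ha b hb => ?_⟩
    rw [hyy] at ha hb ⊢
    rw [le_antisymm ha.2 ha.1, le_antisymm hb.2 hb.1, sub_self, abs_zero]
  obtain ⟨p, hp, hwp⟩ := hthin x hx y hy y hy γ _ _ hγ (hγ.conj hρ hs hxi hyi) hyconst τ hτ'
  have hpS : p ∈ S ∧ p.im ≤ 0 := by
    rcases hp with ⟨a, ha, rfl⟩ | ⟨a, ha, rfl⟩
    · refine ⟨hs.conj_mem _ (hγ.2.2.1 a ha), ?_⟩
      simpa using hγi a
    · exact ⟨hy, hyi.le⟩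
  obtain ⟨q, hq, hqi, hlt⟩ := exists_real_crossing hρ hw hpS.1 (hγi τ) hpS.2 one_pos
  have hwq : densityDist S ρ w q ≤ δ + 1 := by
    linarith [densityDist_nonneg hρ.pos (z := q) (w := p)]
  have h1 := norm_sub_le_of_densityDist_le hρ hw hq hc hψ hlip hlow hwq
  rw [hτA] at h1
  have hqre : 0 ≤ q.re := by
    have h2 := abs_le.1 ((abs_re_le_norm (q - w)).trans h1)
    have h3 := abs_le.1 ((abs_re_le_norm (w - x)).trans hwx)
    have h4 : x.re = m + n * t := ofReal_re _
    rw [sub_re] at h2 h3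
    nlinarith
  rw [densityDist_comm hρ hw hq] at hwq
  have h5 := norm_sub_le_of_densityDist_le hρ hq hw hc hψ hlip hlow hwq
  rw [hψ0 q hqi hqre] at h5
  have h6 := hlip w q
  rw [hτA, hψ0 q hqi hqre] at h6
  nlinarith

/-- The complement in the plane of a subset of the real line. -/
def denjoyDomain (E : Set ℝ) : Set ℂ := ((fun x : ℝ => (x : ℂ)) '' E)ᶜ

/-- A closed set of reals containing an arithmetic progression with step `t` and missing the
intervals of radius `g` about the terms of another one. -/
structure IsRightPeriodic (E : Set ℝ) (t e m g : ℝ) : Prop where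
  isClosed : IsClosed E
  t_pos : 0 < t
  e_nonneg : 0 ≤ e
  e_lt : e < t
  m_nonneg : 0 ≤ m
  g_pos : 0 < g
  mem : ∀ n : ℕ, e + n * t ∈ E
  gap : ∀ n : ℕ, ∀ x ∈ E, g ≤ |m + n * t - x|

/-- The distance to the positive real axis, increased by `t`. -/
def distRay (t : ℝ) (z : ℂ) : ℝ := infDist z ((fun x : ℝ => (x : ℂ)) '' Ici 0) + t

lemma distRay_le_add (t : ℝ) (z w : ℂ) : distRay t z ≤ distRay t w + ‖z - w‖ := by
  have := infDist_le_infDist_add_dist (s := (fun x : ℝ => (x : ℂ)) '' Ici 0) (x := z) (y := w)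
  rw [dist_eq_norm] at this
  unfold distRay
  linarith

lemma le_distRay (t : ℝ) (z : ℂ) : t ≤ distRay t z := by
  unfold distRay
  linarith [infDist_nonneg (x := z) (s := (fun x : ℝ => (x : ℂ)) '' Ici 0)]

lemma distRay_eq {t : ℝ} (hz : z.im = 0) (hz' : 0 ≤ z.re) : distRay t z = t := by
  unfold distRay
  rw [infDist_zero_of_mem, zero_add]
  exact ⟨z.re, hz', Complex.ext (by simp) (by simp [hz])⟩

lemma exists_dist_le_distRay {t : ℝ} (ht : 0 < t) (z : ℂ) :
    ∃ n : ℕ, ∀ e, 0 ≤ e → e < t → ‖z - (e + n * t : ℝ)‖ ≤ distRay t z := by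
  have hcl : IsClosed ((fun x : ℝ => (x : ℂ)) '' Ici 0) :=
    isometry_ofReal.isClosedEmbedding.isClosedMap _ isClosed_Ici
  obtain ⟨_, ⟨q, hq, rfl⟩, hqd⟩ := hcl.exists_infDist_eq_dist ⟨_, 0, self_mem_Ici, rfl⟩ z
  refine ⟨⌊q / t⌋₊, fun e he het => ?_⟩
  have hq' : 0 ≤ q / t := div_nonneg hq ht.le
  have h1 := (le_div_iff₀ ht).1 (Nat.floor_le hq')
  have h2 := (div_lt_iff₀ ht).1 (Nat.lt_floor_add_one (q / t))
  have h3 : ‖((q : ℝ) : ℂ) - (e + ⌊q / t⌋₊ * t : ℝ)‖ ≤ t := by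
    rw [← ofReal_sub, norm_real, Real.norm_eq_abs, abs_le]
    constructor <;> linarith
  have h4 := norm_sub_le_norm_sub_add_norm_sub z q (e + ⌊q / t⌋₊ * t : ℝ)
  rw [dist_eq_norm] at hqd
  unfold distRay
  linarith

namespace IsRightPeriodic

variable {E : Set ℝ} {t e m g : ℝ}

lemma isOpen (h : IsRightPeriodic E t e m g) : IsOpen (denjoyDomain E) :=
  (isometry_ofReal.isClosedEmbedding.isClosedMap _ h.isClosed).isOpen_compl

lemma compl_nonempty (h : IsRightPeriodic E t e m g) : (denjoyDomain E)ᶜ.Nonempty := by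
  rw [denjoyDomain, compl_compl]
  exact ⟨_, _, h.mem 0, rfl⟩

lemma infDist_pos (h : IsRightPeriodic E t e m g) (hz : z ∈ denjoyDomain E) :
    0 < infDist z (denjoyDomain E)ᶜ :=
  (h.isOpen.isClosed_compl.notMem_iff_infDist_pos h.compl_nonempty).1 (by simpa using hz)

lemma infDist_le_distRay (h : IsRightPeriodic E t e m g) (z : ℂ) :
    infDist z (denjoyDomain E)ᶜ ≤ distRay t z := by
  obtain ⟨n, hn⟩ := exists_dist_le_distRay h.t_pos z
  refine le_trans ?_ (hn e h.e_nonneg h.e_lt)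
  rw [← dist_eq_norm]
  refine infDist_le_dist_of_mem ?_
  rw [denjoyDomain, compl_compl]
  exact ⟨_, h.mem n, rfl⟩

lemma le_infDist (h : IsRightPeriodic E t e m g) {d : ℝ} (hd : ∀ x ∈ E, d ≤ ‖z - (x : ℂ)‖) :
    d ≤ infDist z (denjoyDomain E)ᶜ := by
  rw [Metric.le_infDist h.compl_nonempty, denjoyDomain, compl_compl]
  rintro _ ⟨x, hx, rfl⟩
  rw [dist_eq_norm]
  exact hd x hx

lemma abs_im_le_infDist (h : IsRightPeriodic E t e m g) (z : ℂ) :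
    |z.im| ≤ infDist z (denjoyDomain E)ᶜ :=
  h.le_infDist fun x _ => by simpa using abs_im_le_norm (z - x)

lemma mem_of_im_ne_zero (hz : z.im ≠ 0) : z ∈ denjoyDomain E := by
  rintro ⟨x, _, rfl⟩
  simp at hz

lemma gap_mem (h : IsRightPeriodic E t e m g) (n : ℕ) (s : ℝ) :
    ((m + n * t : ℝ) : ℂ) + s * I ∈ denjoyDomain E := by
  rintro ⟨x, hx, hx'⟩
  have h1 := congrArg re hx'
  simp at h1
  have := h.gap n x hx
  rw [← h1, sub_self, abs_zero] at this
  exact this.not_gt h.g_pos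

lemma add_le_infDist (h : IsRightPeriodic E t e m g) (n : ℕ) (s : ℝ) :
    g + |s| ≤ 2 * infDist (((m + n * t : ℝ) : ℂ) + s * I) (denjoyDomain E)ᶜ := by
  have h1 := h.abs_im_le_infDist (((m + n * t : ℝ) : ℂ) + s * I)
  have h2 : g ≤ infDist (((m + n * t : ℝ) : ℂ) + s * I) (denjoyDomain E)ᶜ :=
    h.le_infDist fun x hx => by
      refine (h.gap n x hx).trans ?_
      simpa using abs_re_le_norm (((m + n * t : ℝ) : ℂ) + s * I - x)
  simp at h1
  simp at h2
  push_cast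
  linarith

lemma exists_isC1CurveIn (h : IsRightPeriodic E t e m g) (hz : z ∈ denjoyDomain E)
    (hw : w ∈ denjoyDomain E) : ∃ γ, IsC1CurveIn (denjoyDomain E) z w γ := by
  have hseg : ∀ {z w : ℂ}, (∀ s ∈ Icc (0:ℝ) 1, z + s * (w - z) ∈ denjoyDomain E) →
      ∃ γ, IsC1CurveIn (denjoyDomain E) z w γ := fun {z w} hS =>
    ⟨fun s : ℝ => z + s * (w - z),
      (contDiff_const.add (ofRealCLM.contDiff.mul contDiff_const)).contDiffOn,
      by simp, by simp, hS⟩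
  have htrans : ∀ {x y z : ℂ}, (∃ γ, IsC1CurveIn (denjoyDomain E) x y γ) →
      (∃ γ, IsC1CurveIn (denjoyDomain E) y z γ) →
      ∃ γ, IsC1CurveIn (denjoyDomain E) x z γ := by
    rintro x y z ⟨γ₁, h1⟩ ⟨γ₂, h2⟩
    obtain ⟨γ, h3, -⟩ := h1.trans h2 (ρ := fun _ => 1) continuousOn_const
    exact ⟨γ, h3⟩
  have key : ∀ {z : ℂ}, z ∈ denjoyDomain E →
      ∃ γ, IsC1CurveIn (denjoyDomain E) z ((m + (0:ℕ) * t : ℝ) : ℂ) γ := by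
    intro z hz
    have him : ∀ {z : ℂ}, z.im ≠ 0 →
        ∃ γ, IsC1CurveIn (denjoyDomain E) z ((m + (0:ℕ) * t : ℝ) : ℂ) γ := by
      intro z hz
      refine hseg fun s hs => ?_
      rcases hs.2.lt_or_eq with h1 | rfl
      · refine mem_of_im_ne_zero ?_
        have : (z + s * (((m + (0:ℕ) * t : ℝ) : ℂ) - z)).im = (1 - s) * z.im := by
          simp; ring
        rw [this]
        exact mul_ne_zero (by linarith) hz
      · simpa using h.gap_mem 0 0
    by_cases hz0 : z.im = 0
    · refine htrans (y := z + I) (hseg fun s hs => ?_) (him (by simp [hz0]))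
      rcases hs.1.lt_or_eq with h1 | rfl
      · refine mem_of_im_ne_zero ?_
        simpa [hz0] using h1.ne'
      · simpa using hz
    · exact him hz0
  obtain ⟨γ, hγ⟩ := key hw
  obtain ⟨γ', hγ', -⟩ := hγ.reverse (ρ := fun _ => 1)
  exact htrans (key hz) ⟨γ', hγ'⟩

/-- Densities comparable to the quasihyperbolic one, in a weak sense, on a periodic Denjoy domain
are not Gromov hyperbolic. -/
theorem not_isGromovHyperbolic (h : IsRightPeriodic E t e m g)
    (hcont : ContinuousOn ρ (denjoyDomain E)) (hpos : ∀ z ∈ denjoyDomain E, 0 < ρ z)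
    (hconj : ∀ z ∈ denjoyDomain E, ρ ((starRingEnd ℂ) z) = ρ z)
    (hup : ∀ z ∈ denjoyDomain E, ρ z ≤ 2 / infDist z (denjoyDomain E)ᶜ)
    {c : ℝ} (hc : 0 < c) (hlow : ∀ z ∈ denjoyDomain E, c / distRay t z ≤ ρ z)
    (hcpt : ∀ x ∈ denjoyDomain E, ∀ R : ℝ, ∃ K ⊆ denjoyDomain E, IsCompact K ∧
      ∀ w ∈ denjoyDomain E, densityDist (denjoyDomain E) ρ x w ≤ R → w ∈ K) :
    ¬ IsGromovHyperbolic (denjoyDomain E) (densityDist (denjoyDomain E) ρ) := by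
  have hρ : IsConformalDensity (denjoyDomain E) ρ :=
    ⟨h.isOpen, hcont, hpos, fun z hz w hw => h.exists_isC1CurveIn hz hw⟩
  have hs : IsConjInvariant (denjoyDomain E) ρ := by
    refine ⟨?_, hconj⟩
    rintro z hz ⟨x, hx, hx'⟩
    refine hz ⟨x, hx, ?_⟩
    simpa using congrArg (starRingEnd ℂ) hx'
  refine not_isGromovHyperbolic_of_periodic (C := 4) hρ hs h.t_pos hc h.g_pos h.m_nonneg
    (distRay_le_add t) (le_distRay t) (fun q => distRay_eq) hlow
    (fun z => mem_of_im_ne_zero) h.gap_mem (fun n s => ?_) (fun z hz => ?_) hcpt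
  · refine (hup _ (h.gap_mem n s)).trans ?_
    have h1 := h.infDist_pos (h.gap_mem n s)
    have h2 := h.add_le_infDist n s
    have h3 : 0 < g + |s| := add_pos_of_pos_of_nonneg h.g_pos (abs_nonneg s)
    rw [div_le_div_iff₀ h1 h3]
    linarith
  · refine (hup z (mem_of_im_ne_zero hz)).trans ?_
    have h1 := h.abs_im_le_infDist z
    have h2 := abs_pos.2 hz
    calc 2 / infDist z (denjoyDomain E)ᶜ ≤ 2 / |z.im| := by gcongr
      _ ≤ 4 / |z.im| := by gcongr; norm_num

theorem not_isGromovHyperbolic_qhDist (h : IsRightPeriodic E t e m g) :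
    ¬ IsGromovHyperbolic (denjoyDomain E) (qhDist (denjoyDomain E)) := by
  set δ : ℂ → ℝ := fun z => infDist z (denjoyDomain E)ᶜ with hδ
  have hδc : Continuous δ := continuous_infDist_pt _
  have hδpos : ∀ z ∈ denjoyDomain E, 0 < δ z := fun z hz => h.infDist_pos hz
  have hcont : ContinuousOn (qhDensity (denjoyDomain E)) (denjoyDomain E) :=
    hδc.continuousOn.inv₀ fun z hz => (hδpos z hz).ne'
  have hpos : ∀ z ∈ denjoyDomain E, 0 < qhDensity (denjoyDomain E) z := fun z hz =>
    inv_pos.2 (hδpos z hz)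
  have hρ : IsConformalDensity (denjoyDomain E) (qhDensity (denjoyDomain E)) :=
    ⟨h.isOpen, hcont, hpos, fun z hz w hw => h.exists_isC1CurveIn hz hw⟩
  have hconj : ∀ z, δ ((starRingEnd ℂ) z) ≤ δ z := fun z => by
    refine h.le_infDist fun x hx => ?_
    have : infDist ((starRingEnd ℂ) z) (denjoyDomain E)ᶜ ≤ dist ((starRingEnd ℂ) z) x := by
      refine infDist_le_dist_of_mem ?_
      rw [denjoyDomain, compl_compl]
      exact ⟨x, hx, rfl⟩
    refine this.trans (le_of_eq ?_)
    rw [dist_eq_norm, ← norm_conj, map_sub, conj_conj, conj_ofReal]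
  refine h.not_isGromovHyperbolic hcont hpos (fun z _ => ?_) (fun z hz => ?_) one_pos
    (fun z hz => ?_) fun x hx R => ?_
  · have h1 := hconj ((starRingEnd ℂ) z)
    rw [conj_conj] at h1
    exact congrArg Inv.inv (le_antisymm (hconj z) h1)
  · rw [qhDensity, ← one_div]
    have := h.infDist_pos hz
    gcongr
    norm_num
  · rw [qhDensity, ← one_div]
    exact one_div_le_one_div_of_le (h.infDist_pos hz) (h.infDist_le_distRay z)
  · have hlip : ∀ z w, δ z ≤ δ w + ‖z - w‖ := fun z w => by
      rw [← dist_eq_norm]; exact infDist_le_infDist_add_dist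
    have hlow : ∀ z ∈ denjoyDomain E, 1 / δ z ≤ qhDensity (denjoyDomain E) z := fun z _ => by
      rw [qhDensity, one_div]
    refine ⟨closedBall x (δ x * (Real.exp (R / 1) - 1)) ∩ {w | δ x * Real.exp (-R) ≤ δ w},
      ?_, ?_, fun w hw hwR => ⟨?_, ?_⟩⟩
    · rintro w ⟨-, hw⟩
      by_contra hcon
      have h1 : δ w = 0 := infDist_zero_of_mem hcon
      have h2 : 0 < δ x * Real.exp (-R) := mul_pos (hδpos x hx) (Real.exp_pos _)
      rw [mem_ofPred_eq, h1] at hw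
      linarith
    · exact (isCompact_closedBall _ _).inter_right (isClosed_le continuous_const hδc)
    · rw [mem_closedBall, dist_eq_norm]
      exact norm_sub_le_of_densityDist_le hρ hx hw one_pos hδpos hlip hlow hwR
    · rw [densityDist_comm hρ hx hw] at hwR
      have h1 := norm_sub_le_of_densityDist_le hρ hw hx one_pos hδpos hlip hlow hwR
      have h2 := hlip x w
      rw [div_one] at h1
      rw [mem_ofPred_eq, Real.exp_neg, ← div_eq_mul_inv, div_le_iff₀ (Real.exp_pos _)]
      linarith

end IsRightPeriodic

lemma exists_isRightPeriodic {t : ℝ} (ht : 0 < t) {E₀ : Set ℝ} (hcl : IsClosed E₀)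
    (hne : E₀.Nonempty) (hsub : E₀ ⊆ Ico 0 t) {T : Set ℤ} (hT : ∀ n : ℕ, (n : ℤ) ∈ T) :
    ∃ e m g, IsRightPeriodic {x | ∃ y ∈ E₀, ∃ n ∈ T, y + t * n = x} t e m g := by
  have hcpt : IsCompact E₀ := (isCompact_Icc (a := 0) (b := t)).of_isClosed_subset hcl
    (hsub.trans Ico_subset_Icc_self)
  obtain ⟨a, ha, hmin⟩ := hcpt.exists_isLeast hne
  obtain ⟨b, hb, hmax⟩ := hcpt.exists_isGreatest hne
  have ha' := hsub ha
  have hb' := hsub hb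
  refine ⟨a, (a + b + t) / 2, (a + t - b) / 2, ?_, ht, ha'.1, ha'.2, ?_, ?_, fun n => ?_, ?_⟩
  · have h1 : IsClosed ((fun n : ℤ => t * n) '' T) := by
      have h2 := Int.isClosedEmbedding_coe_real.isClosedMap T (isClosed_discrete T)
      have h3 := (Homeomorph.mulLeft₀ t ht.ne').isClosedMap _ h2
      rwa [image_image] at h3
    convert h1.add_left_of_isCompact hcpt using 1
    ext x
    simp [Set.mem_add]
  · linarith [ha'.1, hb'.1]
  · linarith [ha'.1, hb'.2]
  · exact ⟨a, ha, n, hT n, by push_cast; ring⟩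
  · rintro n _ ⟨y, hy, k, -, rfl⟩
    have h1 := hmin hy
    have h2 := hmax hy
    rcases le_or_gt k n with hk | hk
    · have hk' : (k : ℝ) ≤ n := by exact_mod_cast hk
      refine le_trans ?_ (le_abs_self _)
      nlinarith
    · have hk' : (n : ℝ) + 1 ≤ k := by exact_mod_cast hk
      refine le_trans ?_ (neg_le_abs _)
      nlinarith

/-- `p` is a holomorphic covering map of `Ω` by the unit disk, and `lam` is the density on `Ω` whose
pullback is the hyperbolic density of the disk. -/
structure IsDiskCover (Ω : Set ℂ) (lam : ℂ → ℝ) (p : ℂ → ℂ) : Prop where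
  differentiableOn : DifferentiableOn ℂ p (ball 0 1)
  image_eq : p '' ball (0:ℂ) 1 = Ω
  isCoveringMapOn : IsCoveringMapOn (fun z : ball (0:ℂ) 1 => p z) Ω
  pullback : ∀ z ∈ ball (0:ℂ) 1, lam (p z) * ‖deriv p z‖ = 2 / (1 - ‖z‖ ^ 2)

lemma IsPoincareDensity.exists_isDiskCover {Ω : Set ℂ} {lam : ℂ → ℝ}
    (h : IsPoincareDensity Ω lam) : ∃ p, IsDiskCover Ω lam p := by
  obtain ⟨p, h1, h2, h3, h4⟩ := h
  exact ⟨p, fun z hz => (h1 z hz).differentiableWithinAt, h2, h3, h4⟩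

lemma one_sub_norm_sq_pos (hz : z ∈ ball (0:ℂ) 1) : 0 < 1 - ‖z‖ ^ 2 := by
  rw [mem_ball_zero_iff] at hz
  nlinarith [norm_nonneg z]

namespace IsDiskCover

variable {Ω : Set ℂ} {lam : ℂ → ℝ} {p : ℂ → ℂ}

lemma mapsTo (h : IsDiskCover Ω lam p) (hz : z ∈ ball (0:ℂ) 1) : p z ∈ Ω :=
  h.image_eq ▸ mem_image_of_mem p hz

lemma exists_preimage (h : IsDiskCover Ω lam p) (hw : w ∈ Ω) : ∃ z ∈ ball (0:ℂ) 1, p z = w := by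
  rwa [← h.image_eq] at hw

lemma mul_pos (h : IsDiskCover Ω lam p) (hz : z ∈ ball (0:ℂ) 1) :
    0 < lam (p z) * ‖deriv p z‖ := by
  rw [h.pullback z hz]
  exact div_pos two_pos (one_sub_norm_sq_pos hz)

lemma deriv_ne_zero (h : IsDiskCover Ω lam p) (hz : z ∈ ball (0:ℂ) 1) : deriv p z ≠ 0 := by
  intro h0
  simpa [h0] using h.mul_pos hz

lemma pos (h : IsDiskCover Ω lam p) (hw : w ∈ Ω) : 0 < lam w := by
  obtain ⟨z, hz, rfl⟩ := h.exists_preimage hw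
  exact pos_of_mul_pos_left (h.mul_pos hz) (norm_nonneg _)

lemma analyticAt (h : IsDiskCover Ω lam p) (hz : z ∈ ball (0:ℂ) 1) : AnalyticAt ℂ p z :=
  h.differentiableOn.analyticAt (isOpen_ball.mem_nhds hz)

lemma exists_local_inverse (h : IsDiskCover Ω lam p) (hz : z ∈ ball (0:ℂ) 1) :
    ∃ q : ℂ → ℂ, ContDiffAt ℂ 1 q (p z) ∧ ∀ᶠ x in nhds z, q (p x) = x := by
  have h1 : ContDiffAt ℂ 1 p z := (h.analyticAt hz).contDiffAt
  have h2 := (h.analyticAt hz).differentiableAt.hasDerivAt.hasFDerivAt_equiv (h.deriv_ne_zero hz)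
  exact ⟨_, h1.to_localInverse h2 one_ne_zero,
    (h1.hasStrictFDerivAt' h2 one_ne_zero).eventually_left_inverse⟩

lemma continuousOn (h : IsDiskCover Ω lam p) : ContinuousOn lam Ω := by
  intro w hw
  obtain ⟨z, hz, rfl⟩ := h.exists_preimage hw
  refine ContinuousAt.continuousWithinAt ?_
  have h1 : HasStrictDerivAt p (deriv p z) z := (h.analyticAt hz).hasStrictDerivAt
  rw [ContinuousAt, ← h1.map_nhds_eq (h.deriv_ne_zero hz), tendsto_map'_iff]
  have h2 : ContinuousAt (fun x => 2 / (1 - ‖x‖ ^ 2) / ‖deriv p x‖) z := by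
    refine ContinuousAt.div (ContinuousAt.div continuousAt_const (by fun_prop)
      (one_sub_norm_sq_pos hz).ne') (h.analyticAt hz).deriv.continuousAt.norm ?_
    exact norm_ne_zero_iff.2 (h.deriv_ne_zero hz)
  have heq : ∀ x ∈ ball (0:ℂ) 1, 2 / (1 - ‖x‖ ^ 2) / ‖deriv p x‖ = lam (p x) := fun x hx => by
    rw [← h.pullback x hx, mul_div_assoc, div_self (norm_ne_zero_iff.2 (h.deriv_ne_zero hx)),
      mul_one]
  rw [← heq z hz]
  refine h2.tendsto.congr' ?_
  filter_upwards [isOpen_ball.mem_nhds hz] with x hx using heq x hx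

/-- Lifting of continuous maps on convex sets. -/
lemma exists_lift (h : IsDiskCover Ω lam p) {X : Type*} [NormedAddCommGroup X] [NormedSpace ℝ X]
    {U : Set X} (hU : Convex ℝ U) {f : X → ℂ} (hf : ContinuousOn f U) (hfU : MapsTo f U Ω)
    {x₀ : X} (hx₀ : x₀ ∈ U) {a : ℂ} (ha : a ∈ ball (0:ℂ) 1) (hpa : p a = f x₀) :
    ∃ F : X → ℂ, ContinuousOn F U ∧ MapsTo F U (ball 0 1) ∧ F x₀ = a ∧
      ∀ x ∈ U, p (F x) = f x := by
  classical
  have := hU.contractibleSpace ⟨x₀, hx₀⟩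
  have := hU.locallyPathConnectedSpace
  obtain ⟨F, ⟨hF1, hF2⟩, -⟩ := h.isCoveringMapOn.existsUnique_continuousMap_lifts
    ⟨U.domRestrict f, continuousOn_iff_continuous_domRestrict.1 hf⟩
    (a₀ := ⟨x₀, hx₀⟩) (e₀ := ⟨a, ha⟩) hpa (fun x => hfU x.2)
  obtain ⟨G, hG⟩ : ∃ G : X → ℂ, ∀ z : U, G z = F z :=
    ⟨fun z => if hz : z ∈ U then F ⟨z, hz⟩ else 0, by simp⟩
  refine ⟨G, ?_, fun x hx => ?_, ?_, fun x hx => ?_⟩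
  · rw [continuousOn_iff_continuous_domRestrict]
    have : U.domRestrict G = fun x => (F x : ℂ) := funext hG
    rw [this]
    exact continuous_subtype_val.comp F.continuous
  · rw [hG ⟨x, hx⟩]
    exact (F ⟨x, hx⟩).2
  · rw [hG ⟨x₀, hx₀⟩, hF1]
  · rw [hG ⟨x, hx⟩]
    exact congrFun hF2 ⟨x, hx⟩

/-- Lifts are as smooth as the map being lifted, since they locally factor through it. -/
lemma exists_lift_eventuallyEq (h : IsDiskCover Ω lam p) {X : Type*} [TopologicalSpace X]
    {U : Set X} {f F : X → ℂ} (hF : ContinuousOn F U) (hFU : MapsTo F U (ball 0 1))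
    (hp : ∀ x ∈ U, p (F x) = f x) {x₀ : X} (hx₀ : x₀ ∈ U) :
    ∃ q : ℂ → ℂ, ContDiffAt ℂ 1 q (f x₀) ∧ F =ᶠ[nhdsWithin x₀ U] q ∘ f := by
  obtain ⟨q, hq1, hq2⟩ := h.exists_local_inverse (hFU hx₀)
  rw [hp x₀ hx₀] at hq1
  refine ⟨q, hq1, ?_⟩
  filter_upwards [(hF x₀ hx₀).eventually hq2, self_mem_nhdsWithin] with x h1 h2
  rw [Function.comp_apply, ← hp x h2, h1]

lemma exists_holomorphic_lift (h : IsDiskCover Ω lam p) {f : ℂ → ℂ}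
    (hf : DifferentiableOn ℂ f (ball 0 1)) (hfU : MapsTo f (ball 0 1) Ω)
    {a : ℂ} (ha : a ∈ ball (0:ℂ) 1) (hpa : p a = f 0) :
    ∃ F : ℂ → ℂ, DifferentiableOn ℂ F (ball 0 1) ∧ MapsTo F (ball 0 1) (ball 0 1) ∧ F 0 = a ∧
      ∀ x ∈ ball (0:ℂ) 1, p (F x) = f x := by
  obtain ⟨F, h1, h2, h3, h4⟩ := h.exists_lift (convex_ball 0 1) hf.continuousOn hfU
    (mem_ball_self one_pos) ha hpa
  refine ⟨F, fun x hx => ?_, h2, h3, h4⟩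
  obtain ⟨q, hq1, hq2⟩ := h.exists_lift_eventuallyEq h1 h2 h4 hx
  exact ((hq1.differentiableAt one_ne_zero).comp_differentiableWithinAt x
    (hf x hx)).congr_of_eventuallyEq hq2 (hq2.self_of_nhdsWithin hx)

lemma exists_curve_lift (h : IsDiskCover Ω lam p) (hγ : IsC1CurveIn Ω z w γ) {a : ℂ}
    (ha : a ∈ ball (0:ℂ) 1) (hpa : p a = z) :
    ∃ b γ', IsC1CurveIn (ball 0 1) a b γ' ∧ p b = w ∧
      curveLen (fun z => 2 / (1 - ‖z‖ ^ 2)) γ' = curveLen lam γ := by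
  obtain ⟨γ', h1, h2, h3, h4⟩ := h.exists_lift (convex_Icc (0:ℝ) 1) hγ.1.continuousOn
    (fun s hs => hγ.2.2.2 s hs) (x₀ := 0) (by simp) ha (hpa.trans hγ.2.1.symm)
  have hC : IsC1CurveIn (ball 0 1) a (γ' 1) γ' := by
    refine ⟨fun s hs => ?_, h3, rfl, h2⟩
    obtain ⟨q, hq1, hq2⟩ := h.exists_lift_eventuallyEq h1 h2 h4 hs
    exact ((hq1.restrict_scalars ℝ).comp_contDiffWithinAt s (hγ.1 s hs)).congr_of_eventuallyEq
      hq2 (hq2.self_of_nhdsWithin hs)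
  refine ⟨γ' 1, γ', hC, (h4 1 (by simp)).trans hγ.2.2.1, ?_⟩
  refine intervalIntegral.integral_congr_uIoo fun s hs => ?_
  rw [uIoo_of_le zero_le_one] at hs
  have hs' := Ioo_subset_Icc_self hs
  have h5 := (h.analyticAt (h2 hs')).differentiableAt.hasDerivAt.scomp s (hC.hasDerivAt hs)
  have h6 : HasDerivAt γ (derivWithin γ' (Icc 0 1) s • deriv p (γ' s)) s := by
    refine h5.congr_of_eventuallyEq ?_
    filter_upwards [Icc_mem_nhds hs.1 hs.2] with u hu using (h4 u hu).symm
  simp only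
  rw [(hC.hasDerivAt hs).deriv, h6.deriv, ← h.pullback _ (h2 hs'), h4 s hs', norm_smul]
  ring

/-- The lift of a curve of length `L` stays away from the unit circle. -/
lemma exists_preimage_of_curve (h : IsDiskCover Ω lam p) (hγ : IsC1CurveIn Ω z w γ) {a : ℂ}
    (ha : a ∈ ball (0:ℂ) 1) (hpa : p a = z) :
    ∃ b ∈ ball (0:ℂ) 1, p b = w ∧ (1 - ‖a‖) * Real.exp (-curveLen lam γ) ≤ 1 - ‖b‖ := by
  obtain ⟨b, γ', h1, h2, h3⟩ := h.exists_curve_lift hγ ha hpa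
  have hb : b ∈ ball (0:ℂ) 1 := h1.2.2.1 ▸ h1.2.2.2 1 (by simp)
  have hb1 : ‖b‖ < 1 := mem_ball_zero_iff.1 hb
  refine ⟨b, hb, h2, ?_⟩
  obtain ⟨η, h4, h5⟩ := h1.reverse (ρ := fun z => 2 / (1 - ‖z‖ ^ 2))
  have hcont : ContinuousOn (fun z : ℂ => 2 / (1 - ‖z‖ ^ 2)) (ball 0 1) :=
    continuousOn_const.div (by fun_prop) fun z hz => (one_sub_norm_sq_pos hz).ne'
  have h6 := h4.mul_log_le_curveLen hcont one_pos (sub_pos.2 hb1) fun s hs => by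
    have h7 := h4.2.2.2 s hs
    have h8 := one_sub_norm_sq_pos h7
    rw [mem_ball_zero_iff] at h7
    have h10 := norm_nonneg (η s - b)
    rw [div_le_div_iff₀ (by linarith) h8]
    have h11 := norm_nonneg (η s)
    rw [norm_sub_rev] at h10 ⊢
    have h12 : ‖b‖ ≤ ‖η s‖ + ‖b - η s‖ := by
      have := norm_add_le (η s) (b - η s)
      rwa [add_sub_cancel] at this
    nlinarith
  rw [h5, h3, one_mul, Real.log_le_iff_le_exp (by
    have : 0 ≤ ‖a - b‖ / (1 - ‖b‖) := div_nonneg (norm_nonneg _) (sub_pos.2 hb1).le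
    linarith)] at h6
  have h7 : 1 - ‖a‖ ≤ 1 - ‖b‖ + ‖a - b‖ := by
    have := norm_sub_norm_le b a
    rw [norm_sub_rev] at this
    linarith
  rw [Real.exp_neg, ← div_eq_mul_inv, div_le_iff₀ (Real.exp_pos _)]
  have h8 := mul_le_mul_of_nonneg_left h6 (sub_pos.2 hb1).le
  rw [mul_add, mul_one, mul_div_cancel₀ _ (sub_pos.2 hb1).ne'] at h8
  linarith

lemma exists_compact (h : IsDiskCover Ω lam p) (hρ : IsConformalDensity Ω lam) (hx : x ∈ Ω)
    (R : ℝ) : ∃ K ⊆ Ω, IsCompact K ∧ ∀ w ∈ Ω, densityDist Ω lam x w ≤ R → w ∈ K := by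
  obtain ⟨a, ha, hpa⟩ := h.exists_preimage hx
  have ha1 : ‖a‖ < 1 := mem_ball_zero_iff.1 ha
  have hr : 1 - (1 - ‖a‖) * Real.exp (-(R + 1)) < 1 := by
    have := _root_.mul_pos (sub_pos.2 ha1) (Real.exp_pos (-(R + 1)))
    linarith
  have hsub := closedBall_subset_ball (x := (0:ℂ)) hr
  refine ⟨p '' closedBall 0 (1 - (1 - ‖a‖) * Real.exp (-(R + 1))), ?_, ?_, fun w hw hwR => ?_⟩
  · rintro _ ⟨z, hz, rfl⟩
    exact h.mapsTo (hsub hz)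
  · exact (isCompact_closedBall _ _).image_of_continuousOn
      (h.differentiableOn.continuousOn.mono hsub)
  · obtain ⟨γ, hγ, hlen⟩ := exists_curveLen_lt hρ hx hw (hwR.trans_lt (lt_add_one R))
    obtain ⟨b, hb, hpb, hb'⟩ := h.exists_preimage_of_curve hγ ha hpa
    refine ⟨b, ?_, hpb⟩
    rw [mem_closedBall_zero_iff]
    have : (1 - ‖a‖) * Real.exp (-(R + 1)) ≤ (1 - ‖a‖) * Real.exp (-curveLen lam γ) := by
      have := sub_pos.2 ha1
      gcongr
    linarith

end IsDiskCover

/-- The Möbius transformation of the unit disk taking `0` to `a`. -/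
def diskMobius (a z : ℂ) : ℂ := (z + a) / (1 + (starRingEnd ℂ) a * z)

section diskMobius

variable {a : ℂ}

lemma diskMobius_denom_sub (a z : ℂ) :
    ‖1 + (starRingEnd ℂ) a * z‖ ^ 2 - ‖z + a‖ ^ 2 = (1 - ‖a‖ ^ 2) * (1 - ‖z‖ ^ 2) := by
  simp only [← normSq_eq_norm_sq, normSq_apply, add_re, add_im, mul_re, mul_im, one_re, one_im,
    conj_re, conj_im]
  ring

lemma diskMobius_denom_ne_zero (ha : a ∈ ball (0:ℂ) 1) (hz : z ∈ ball (0:ℂ) 1) :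
    1 + (starRingEnd ℂ) a * z ≠ 0 := by
  intro h
  have h1 := diskMobius_denom_sub a z
  have h2 := mul_pos (one_sub_norm_sq_pos ha) (one_sub_norm_sq_pos hz)
  rw [h, norm_zero] at h1
  nlinarith [sq_nonneg ‖z + a‖]

lemma diskMobius_mem (ha : a ∈ ball (0:ℂ) 1) (hz : z ∈ ball (0:ℂ) 1) :
    diskMobius a z ∈ ball (0:ℂ) 1 := by
  have h1 := diskMobius_denom_sub a z
  have h2 := mul_pos (one_sub_norm_sq_pos ha) (one_sub_norm_sq_pos hz)
  rw [mem_ball_zero_iff, diskMobius, norm_div,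
    div_lt_one (norm_pos_iff.2 (diskMobius_denom_ne_zero ha hz))]
  exact lt_of_pow_lt_pow_left₀ 2 (norm_nonneg _) (by linarith)

lemma hasDerivAt_diskMobius (ha : a ∈ ball (0:ℂ) 1) (hz : z ∈ ball (0:ℂ) 1) :
    HasDerivAt (diskMobius a)
      ((1 - (starRingEnd ℂ) a * a) / (1 + (starRingEnd ℂ) a * z) ^ 2) z := by
  have h1 : HasDerivAt (fun z => z + a) 1 z := (hasDerivAt_id z).add_const a
  have h2 : HasDerivAt (fun z => 1 + (starRingEnd ℂ) a * z) ((starRingEnd ℂ) a * 1) z :=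
    ((hasDerivAt_id z).const_mul _).const_add 1
  exact (h1.div h2 (diskMobius_denom_ne_zero ha hz)).congr_deriv (by ring)

lemma differentiableOn_diskMobius (ha : a ∈ ball (0:ℂ) 1) :
    DifferentiableOn ℂ (diskMobius a) (ball 0 1) := fun _ hz =>
  (hasDerivAt_diskMobius ha hz).differentiableAt.differentiableWithinAt

end diskMobius

/-- The Schwarz–Pick lemma at the origin. -/
lemma norm_deriv_zero_le_one_sub_sq {F : ℂ → ℂ} (hF : DifferentiableOn ℂ F (ball 0 1))
    (hmaps : MapsTo F (ball 0 1) (ball 0 1)) : ‖deriv F 0‖ ≤ 1 - ‖F 0‖ ^ 2 := by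
  have h0 : (0:ℂ) ∈ ball (0:ℂ) 1 := mem_ball_self one_pos
  set a := F 0 with ha_def
  have ha : a ∈ ball (0:ℂ) 1 := hmaps h0
  have hna : -a ∈ ball (0:ℂ) 1 := by simpa using ha
  have h1 : DifferentiableOn ℂ (diskMobius (-a) ∘ F) (ball 0 1) :=
    (differentiableOn_diskMobius hna).comp hF hmaps
  have h2 : (diskMobius (-a) ∘ F) 0 = 0 := by simp [diskMobius, ← ha_def]
  have h3 := norm_deriv_le_one_of_mapsTo_ball (c := 0) h1 (by
    intro z hz
    rw [h2]
    exact ball_subset_closedBall (diskMobius_mem hna (hmaps hz))) one_pos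
  have hF0 := (hF.differentiableAt (isOpen_ball.mem_nhds h0)).hasDerivAt
  have h4 := (hasDerivAt_diskMobius hna ha).comp (0:ℂ) hF0
  rw [h4.deriv, norm_mul] at h3
  have h5 : ((1:ℂ) - (starRingEnd ℂ) (-a) * (-a)) = ((1 - ‖a‖ ^ 2 : ℝ) : ℂ) := by
    rw [map_neg, neg_mul_neg, conj_mul']; push_cast; ring
  have h6 : (1:ℂ) + (starRingEnd ℂ) (-a) * a = ((1 - ‖a‖ ^ 2 : ℝ) : ℂ) := by
    rw [map_neg, neg_mul, conj_mul']; push_cast; ring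
  have h7 := one_sub_norm_sq_pos ha
  rw [h5, h6, norm_div, norm_pow, norm_real, Real.norm_of_nonneg h7.le] at h3
  have h8 : (1 - ‖a‖ ^ 2) / (1 - ‖a‖ ^ 2) ^ 2 = (1 - ‖a‖ ^ 2)⁻¹ := by field_simp
  rwa [h8, inv_mul_le_iff₀ h7, mul_one] at h3

namespace IsDiskCover

variable {Ω : Set ℂ} {lam : ℂ → ℝ} {p : ℂ → ℂ}

/-- Holomorphic maps of the disk into `Ω` are contractions of the hyperbolic metrics. -/
lemma mul_norm_deriv_le (h : IsDiskCover Ω lam p) {f : ℂ → ℂ}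
    (hf : DifferentiableOn ℂ f (ball 0 1)) (hfU : MapsTo f (ball 0 1) Ω) :
    lam (f 0) * ‖deriv f 0‖ ≤ 2 := by
  have h0 : (0:ℂ) ∈ ball (0:ℂ) 1 := mem_ball_self one_pos
  obtain ⟨a, ha, hpa⟩ := h.exists_preimage (hfU h0)
  obtain ⟨F, hF1, hF2, hF3, hF4⟩ := h.exists_holomorphic_lift hf hfU ha hpa
  have h1 := norm_deriv_zero_le_one_sub_sq hF1 hF2
  have h2 : HasDerivAt f (deriv p a * deriv F 0) 0 := by
    have h3 := (h.analyticAt (hF2 h0)).differentiableAt.hasDerivAt.comp (0:ℂ)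
      (hF1.differentiableAt (isOpen_ball.mem_nhds h0)).hasDerivAt
    rw [hF3] at h3
    refine h3.congr_of_eventuallyEq ?_
    filter_upwards [isOpen_ball.mem_nhds h0] with z hz using (hF4 z hz).symm
  rw [h2.deriv, norm_mul, ← hpa, ← mul_assoc, h.pullback a ha, div_mul_eq_mul_div,
    div_le_iff₀ (one_sub_norm_sq_pos ha)]
  rw [hF3] at h1
  linarith

/-- At each point some holomorphic map of the disk into `Ω` attains equality in
`IsDiskCover.mul_norm_deriv_le`. -/
lemma exists_mul_norm_deriv_eq (h : IsDiskCover Ω lam p) (hw : w ∈ Ω) :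
    ∃ f : ℂ → ℂ, DifferentiableOn ℂ f (ball 0 1) ∧ MapsTo f (ball 0 1) Ω ∧ f 0 = w ∧
      lam w * ‖deriv f 0‖ = 2 := by
  have h0 : (0:ℂ) ∈ ball (0:ℂ) 1 := mem_ball_self one_pos
  obtain ⟨a, ha, rfl⟩ := h.exists_preimage hw
  have hM : diskMobius a 0 = a := by simp [diskMobius]
  refine ⟨p ∘ diskMobius a, h.differentiableOn.comp (differentiableOn_diskMobius ha)
    fun z hz => diskMobius_mem ha hz, fun z hz => h.mapsTo (diskMobius_mem ha hz), by simp [hM], ?_⟩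
  have h1 := (h.analyticAt (diskMobius_mem ha h0)).differentiableAt.hasDerivAt.comp (0:ℂ)
    (hasDerivAt_diskMobius ha h0)
  have h5 : ((1:ℂ) - (starRingEnd ℂ) a * a) = ((1 - ‖a‖ ^ 2 : ℝ) : ℂ) := by
    rw [conj_mul']; push_cast; ring
  have h7 := one_sub_norm_sq_pos ha
  rw [h1.deriv, hM, h5, norm_mul, ← mul_assoc, h.pullback a ha, mul_zero, add_zero, one_pow,
    div_one, norm_real, Real.norm_of_nonneg h7.le, div_mul_cancel₀ _ h7.ne']

lemma le_two_div_infDist (h : IsDiskCover Ω lam p) (hpos : 0 < infDist w Ωᶜ) :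
    lam w ≤ 2 / infDist w Ωᶜ := by
  set δ := infDist w Ωᶜ
  have hd : ∀ z, HasDerivAt (fun z : ℂ => w + δ * z) δ z := fun z => by
    simpa using ((hasDerivAt_id z).const_mul (δ : ℂ)).const_add w
  have h1 := h.mul_norm_deriv_le (f := fun z => w + δ * z)
    (fun z _ => (hd z).differentiableAt.differentiableWithinAt) fun z hz => by
      by_contra hcon
      have h2 : δ ≤ dist w (w + δ * z) := infDist_le_dist_of_mem hcon
      rw [dist_self_add_right, norm_mul, norm_real, Real.norm_of_nonneg hpos.le] at h2
      rw [mem_ball_zero_iff] at hz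
      nlinarith
  rw [(hd 0).deriv, mul_zero, add_zero, norm_real, Real.norm_of_nonneg hpos.le] at h1
  rwa [le_div_iff₀ hpos]

lemma apply_conj (h : IsDiskCover Ω lam p) (hΩ : ∀ z ∈ Ω, (starRingEnd ℂ) z ∈ Ω) (hw : w ∈ Ω) :
    lam ((starRingEnd ℂ) w) = lam w := by
  have key : ∀ w ∈ Ω, lam ((starRingEnd ℂ) w) ≤ lam w := by
    intro w hw
    obtain ⟨f, h1, h2, rfl, h4⟩ := h.exists_mul_norm_deriv_eq hw
    have hball : ∀ z ∈ ball (0:ℂ) 1, (starRingEnd ℂ) z ∈ ball (0:ℂ) 1 := fun z hz => by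
      simpa using hz
    have h5 : DifferentiableOn ℂ ((starRingEnd ℂ) ∘ f ∘ (starRingEnd ℂ)) (ball 0 1) := by
      intro z hz
      have := (h1.differentiableAt (isOpen_ball.mem_nhds (hball z hz))).conj_conj
      rw [conj_conj] at this
      exact this.differentiableWithinAt
    have h6 := h.mul_norm_deriv_le h5 fun z hz => hΩ _ (h2 (hball z hz))
    rw [deriv_conj_conj, Function.comp_apply, Function.comp_apply, Function.comp_apply,
      Function.comp_apply, map_zero, norm_conj, ← h4] at h6
    refine le_of_mul_le_mul_right h6 (norm_pos_iff.2 fun h0 => ?_)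
    rw [h0, norm_zero, mul_zero] at h4
    norm_num at h4
  refine le_antisymm (key w hw) ?_
  simpa using key _ (hΩ w hw)

end IsDiskCover

theorem IsRightPeriodic.not_isGromovHyperbolic_of_landau {E : Set ℝ} {t e m g : ℝ}
    (h : IsRightPeriodic E t e m g) {lam : ℂ → ℝ} (hlam : IsPoincareDensity (denjoyDomain E) lam)
    {K : ℝ} (hK : 0 < K) (hL : ∀ F : ℂ → ℂ, DifferentiableOn ℂ F (ball 0 1) →
      (∀ z ∈ ball (0:ℂ) 1, ∀ n : ℕ, F z ≠ n) → ‖F 0‖ ≤ 1 → ‖deriv F 0‖ ≤ K) :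
    ¬ IsGromovHyperbolic (denjoyDomain E) (densityDist (denjoyDomain E) lam) := by
  obtain ⟨p, hp⟩ := hlam.exists_isDiskCover
  have hρ : IsConformalDensity (denjoyDomain E) lam :=
    ⟨h.isOpen, hp.continuousOn, fun _ => hp.pos, fun z hz w hw => h.exists_isC1CurveIn hz hw⟩
  have hconj : ∀ z ∈ denjoyDomain E, (starRingEnd ℂ) z ∈ denjoyDomain E := by
    rintro z hz ⟨x, hx, hx'⟩
    refine hz ⟨x, hx, ?_⟩
    simpa using congrArg (starRingEnd ℂ) hx'
  refine h.not_isGromovHyperbolic hp.continuousOn (fun _ => hp.pos)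
    (fun z => hp.apply_conj hconj) (fun z hz => hp.le_two_div_infDist (h.infDist_pos hz))
    (c := 1 / K) (by positivity) (fun w hw => ?_) fun x hx => hp.exists_compact hρ hx
  obtain ⟨f, h1, h2, h3, h4⟩ := hp.exists_mul_norm_deriv_eq hw
  obtain ⟨n, hn⟩ := exists_dist_le_distRay h.t_pos w
  have hn := hn e h.e_nonneg h.e_lt
  have ht := h.t_pos
  have hψ := le_distRay t w
  set ψ := distRay t w with hψ_def
  have hψ0 : 0 < ψ := ht.trans_le hψ
  set N := ⌈ψ / t⌉₊ with hN_def
  have hN1 : ψ ≤ N * t := (div_le_iff₀ ht).1 (Nat.le_ceil _)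
  have hN2 : N * t ≤ 2 * ψ := by
    have h5 := Nat.ceil_lt_add_one (show 0 ≤ ψ / t by positivity)
    have h6 : (ψ / t + 1) * t = ψ + t := by field_simp
    nlinarith
  have hN0 : 0 < N * t := hψ0.trans_le hN1
  have hNc : ((N * t : ℝ) : ℂ) ≠ 0 := ofReal_ne_zero.2 hN0.ne'
  have h5 := hL (fun z => (f z - (e + n * t : ℝ)) / (N * t : ℝ)) ((h1.sub_const _).div_const _)
    (fun z hz k hk => ?_) ?_
  · rw [deriv_div_const, deriv_sub_const, norm_div, norm_real, Real.norm_of_nonneg hN0.le,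
      div_le_iff₀ hN0] at h5
    have h6 : 0 < lam w := hp.pos hw
    rw [div_div, div_le_iff₀ (by positivity)]
    have h7 : ‖deriv f 0‖ ≤ K * (2 * ψ) := h5.trans (by gcongr)
    have h8 := mul_le_mul_of_nonneg_left h7 h6.le
    rw [h4] at h8
    linarith
  · refine h2 hz ⟨_, h.mem (n + k * N), ?_⟩
    rw [div_eq_iff hNc] at hk
    rw [sub_eq_iff_eq_add] at hk
    rw [hk]
    push_cast
    ring
  · rw [h3, norm_div, norm_real, Real.norm_of_nonneg hN0.le, div_le_one hN0]
    exact hn.trans hN1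

/-- A form of Bloch's theorem with an explicit, non-optimal constant. -/
theorem exists_ball_subset_image_of_differentiableOn {f : ℂ → ℂ}
    (hf : DifferentiableOn ℂ f (ball 0 1)) :
    ∃ w, ball w (‖deriv f 0‖ / 96) ⊆ f '' ball 0 1 := by
  have hd : DifferentiableOn ℂ (deriv f) (ball 0 1) := hf.deriv isOpen_ball
  have hsub : closedBall (0:ℂ) (1 / 2) ⊆ ball 0 1 := closedBall_subset_ball (by norm_num)
  obtain ⟨a, ha, hmax⟩ := (isCompact_closedBall (0:ℂ) (1 / 2)).exists_isMaxOn
    (nonempty_closedBall.2 (by norm_num)) (f := fun z => (1 / 2 - ‖z‖) * ‖deriv f z‖)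
    ((continuousOn_const.sub continuous_norm.continuousOn).mul (hd.continuousOn.mono hsub).norm)
  have h0 : 1 / 2 * ‖deriv f 0‖ ≤ (1 / 2 - ‖a‖) * ‖deriv f a‖ := by
    simpa using hmax (mem_closedBall_self (by norm_num) : (0:ℂ) ∈ closedBall (0:ℂ) (1 / 2))
  rcases eq_or_ne (deriv f 0) 0 with hz | hz
  · exact ⟨0, by simp [hz]⟩
  have hz' := norm_pos_iff.2 hz
  rw [mem_closedBall_zero_iff] at ha
  set M := ‖deriv f a‖ with hM_def
  have hM : 0 < M := (norm_nonneg _).lt_of_ne fun h => by rw [hM_def, ← h] at h0; linarith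
  set s := (1 / 2 - ‖a‖) / 2 with hs_def
  have hs : 0 < s := by
    rcases ha.lt_or_eq with h | h
    · rw [hs_def]; linarith
    · rw [h] at h0; linarith
  have hsball : ball a s ⊆ ball 0 1 := fun z hz => by
    rw [mem_ball_iff_norm] at hz
    rw [mem_ball_zero_iff]
    linarith [norm_le_norm_add_norm_sub' z a]
  have hbound : MapsTo (deriv f) (ball a s) (closedBall (deriv f a) (3 * M)) := fun z hz => by
    rw [mem_ball_iff_norm] at hz
    have h1 : ‖z‖ ≤ ‖a‖ + s := by linarith [norm_le_norm_add_norm_sub' z a]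
    have h2 : (1 / 2 - ‖z‖) * ‖deriv f z‖ ≤ (1 / 2 - ‖a‖) * M :=
      hmax (mem_closedBall_zero_iff.2 (by linarith))
    have h3 : s * ‖deriv f z‖ ≤ s * (2 * M) := by
      have := mul_le_mul_of_nonneg_right (show s ≤ 1 / 2 - ‖z‖ by linarith)
        (norm_nonneg (deriv f z))
      have h4 : 1 / 2 - ‖a‖ = 2 * s := by rw [hs_def]; ring
      rw [h4] at h2
      linarith
    rw [mem_closedBall_iff_norm]
    linarith [norm_sub_le (deriv f z) (deriv f a), le_of_mul_le_mul_left h3 hs]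
  have hub : closedBall a (s / 6) ⊆ ball a s := closedBall_subset_ball (by linarith)
  have hda : ∀ z ∈ ball a s, HasDerivAt f (deriv f z) z := fun z hz =>
    (hf.differentiableAt (isOpen_ball.mem_nhds (hsball hz))).hasDerivAt
  have hlip : ∀ z ∈ closedBall a (s / 6),
      ‖(f z - deriv f a * z) - (f a - deriv f a * a)‖ ≤ M / 2 * ‖z - a‖ := fun z hz => by
    refine (convex_closedBall a (s / 6)).norm_image_sub_le_of_norm_hasDerivWithin_le
      (f := fun z => f z - deriv f a * z) (f' := fun z => deriv f z - deriv f a) (fun w hw => ?_)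
      (fun w hw => ?_) (mem_closedBall_self (by linarith)) hz
    · have := (hda w (hub hw)).sub ((hasDerivAt_id w).const_mul (deriv f a))
      rw [mul_one] at this
      exact this.hasDerivWithinAt
    · have h1 := dist_le_div_mul_dist_of_mapsTo_ball (hd.mono hsball) hbound (hub hw)
      rw [← dist_eq_norm]
      calc _ ≤ 3 * M / s * dist w a := h1
        _ ≤ 3 * M / s * (s / 6) := by gcongr; exact hw
        _ = M / 2 := by field_simp; ring
  have hsphere : ∀ z ∈ sphere a (s / 6), M * s / 12 ≤ ‖f z - f a‖ := fun z hz => by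
    have h1 := hlip z (sphere_subset_closedBall hz)
    have h2 : ‖z - a‖ = s / 6 := by rwa [← mem_sphere_iff_norm]
    have h3 : ‖deriv f a * (z - a)‖ ≤ ‖f z - f a‖ +
        ‖(f z - deriv f a * z) - (f a - deriv f a * a)‖ := by
      refine le_trans (le_of_eq ?_) (norm_sub_le _ _)
      congr 1; ring
    rw [norm_mul, ← hM_def, h2] at h3
    rw [h2] at h1
    linarith
  have hne : ∃ᶠ z in nhds a, f z ≠ f a :=
    ((hda a (mem_ball_self hs)).eventually_ne (norm_pos_iff.1 hM)).frequently.filter_mono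
      nhdsWithin_le_nhds
  refine ⟨f a, (ball_subset_ball ?_).trans ((DiffContOnCl.ball_subset_image_closedBall
    ((hf.mono hsball).diffContOnCl_ball hub) (by linarith) hsphere hne).trans
    (image_mono (hub.trans hsball)))⟩
  have : (1 / 2 - ‖a‖) * M = 2 * (M * s) := by rw [hs_def]; ring
  linarith

/-- A nonvanishing holomorphic function on the disk has a holomorphic logarithm. -/
theorem exists_differentiableOn_exp_eq {g : ℂ → ℂ} (hg : DifferentiableOn ℂ g (ball 0 1))
    (hg0 : ∀ z ∈ ball (0:ℂ) 1, g z ≠ 0) :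
    ∃ l : ℂ → ℂ, DifferentiableOn ℂ l (ball 0 1) ∧ ∀ z ∈ ball (0:ℂ) 1, exp (l z) = g z := by
  have h0 : (0:ℂ) ∈ ball (0:ℂ) 1 := mem_ball_self one_pos
  obtain ⟨l, hl0, hl⟩ := (((hg.deriv isOpen_ball).div hg hg0).isExactOn_ball).with_val_at 0
    (log (g 0))
  refine ⟨l, fun z hz => (hl z hz).differentiableAt.differentiableWithinAt, fun z hz => ?_⟩
  have hder : ∀ z ∈ ball (0:ℂ) 1, HasDerivAt (fun z => g z * exp (-l z)) 0 z := fun z hz => by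
    have h1 := (hg.differentiableAt (isOpen_ball.mem_nhds hz)).hasDerivAt.mul (hl z hz).neg.cexp
    refine h1.congr_deriv ?_
    have := hg0 z hz
    simp only [Pi.div_apply, Pi.neg_apply]
    field_simp
    ring
  have h2 := isOpen_ball.is_const_of_deriv_eq_zero (convex_ball (0:ℂ) 1).isPreconnected
    (fun z hz => (hder z hz).differentiableAt.differentiableWithinAt)
    (fun z hz => (hder z hz).deriv) hz h0
  simp only [hl0, exp_neg, exp_log (hg0 0 h0), mul_inv_cancel₀ (hg0 0 h0)] at h2
  exact ((mul_inv_eq_one₀ (exp_ne_zero _)).1 h2).symm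

/-- A holomorphic function on the disk omitting `1` and `-1` is the cosine of a holomorphic
function. -/
theorem exists_differentiableOn_cos_eq {G : ℂ → ℂ} (hG : DifferentiableOn ℂ G (ball 0 1))
    (h1 : ∀ z ∈ ball (0:ℂ) 1, G z ≠ 1) (h2 : ∀ z ∈ ball (0:ℂ) 1, G z ≠ -1) :
    ∃ h : ℂ → ℂ, DifferentiableOn ℂ h (ball 0 1) ∧ ∀ z ∈ ball (0:ℂ) 1, cos (h z) = G z := by
  obtain ⟨l, hl, hle⟩ := exists_differentiableOn_exp_eq (g := fun z => 1 - G z ^ 2)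
    ((differentiableOn_const 1).sub (hG.pow 2)) fun z hz h => by
      rcases sq_eq_sq_iff_eq_or_eq_neg.1 ((sub_eq_zero.1 h).symm.trans (one_pow 2).symm) with h | h
      exacts [h1 z hz h, h2 z hz h]
  have hsq : ∀ z ∈ ball (0:ℂ) 1, exp (l z / 2) ^ 2 = 1 - G z ^ 2 := fun z hz => by
    rw [← exp_nat_mul, ← hle z hz]
    congr 1; push_cast; ring
  have hmul : ∀ z ∈ ball (0:ℂ) 1,
      (G z + I * exp (l z / 2)) * (G z - I * exp (l z / 2)) = 1 := fun z hz => by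
    linear_combination hsq z hz - exp (l z / 2) ^ 2 * I_sq
  obtain ⟨k, hk, hke⟩ := exists_differentiableOn_exp_eq (g := fun z => G z + I * exp (l z / 2))
    (hG.add ((hl.div_const 2).cexp.const_mul I)) fun z hz => left_ne_zero_of_mul_eq_one (hmul z hz)
  refine ⟨fun z => -I * k z, hk.const_mul _, fun z hz => ?_⟩
  have h3 : -I * k z * I = k z := by linear_combination -k z * I_sq
  have h4 : exp (-k z) = G z - I * exp (l z / 2) := by
    rw [exp_neg, hke z hz]
    exact inv_eq_of_mul_eq_one_right (hmul z hz)
  rw [cos, neg_mul (-I * k z), h3, h4, hke z hz]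
  ring

/-- The preimage of the odd positive integers under the cosine is a net in the plane. -/
lemma exists_cos_eq_mem_ball (w : ℂ) : ∃ v ∈ ball w 6, ∃ n : ℕ, cos v = 2 * n - 1 := by
  have hy : ∀ y : ℝ, 0 ≤ y → ∃ τ : ℝ, |τ - y| ≤ 2 ∧ ∃ n : ℕ, Real.cosh τ = 2 * n - 1 := by
    intro y hy
    have hC := Real.one_le_cosh y
    set k := ⌊(Real.cosh y + 1) / 2⌋₊ with hk_def
    have hk1 : 1 ≤ k := Nat.le_floor (by push_cast; linarith)
    have hk1' : (1:ℝ) ≤ k := by exact_mod_cast hk1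
    have hk2 : (k:ℝ) ≤ (Real.cosh y + 1) / 2 := Nat.floor_le (by linarith)
    have hk3 : (Real.cosh y + 1) / 2 < k + 1 := Nat.lt_floor_add_one _
    have hτ : Real.cosh (Real.arcosh (2 * k - 1)) = 2 * k - 1 := Real.cosh_arcosh (by linarith)
    have hτ0 : 0 ≤ Real.arcosh (2 * k - 1) := Real.arcosh_nonneg (by linarith)
    refine ⟨Real.arcosh (2 * k - 1), ?_, k, hτ⟩
    set τ := Real.arcosh (2 * k - 1)
    have h1 : τ ≤ y := by
      rw [← abs_of_nonneg hτ0, ← abs_of_nonneg hy, ← Real.cosh_le_cosh, hτ]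
      linarith
    have h2 : Real.exp y ≤ Real.exp (2 + τ) := by
      have h3 : Real.exp (-τ) ≤ Real.exp τ := Real.exp_le_exp.2 (by linarith)
      have h4 : (6:ℝ) ≤ Real.exp 2 := by
        have h5 := Real.exp_one_gt_d9
        have h6 : Real.exp 2 = Real.exp 1 * Real.exp 1 := by rw [← Real.exp_add]; norm_num
        nlinarith
      have h7 := Real.cosh_eq y
      have h8 := Real.cosh_eq τ
      have h9 := Real.exp_pos (-y)
      rw [Real.exp_add]
      nlinarith [Real.exp_pos τ]
    rw [abs_le]
    constructor <;> linarith [Real.exp_le_exp.1 h2]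
  obtain ⟨τ, hτ, n, hn⟩ : ∃ τ : ℝ, |τ - w.im| ≤ 2 ∧ ∃ n : ℕ, Real.cosh τ = 2 * n - 1 := by
    rcases le_total 0 w.im with h | h
    · exact hy _ h
    · obtain ⟨τ, h1, n, h2⟩ := hy (-w.im) (by linarith)
      refine ⟨-τ, ?_, n, by rwa [Real.cosh_neg]⟩
      rw [← abs_neg]
      convert h1 using 2
      ring
  have hπ := Real.pi_pos
  have hm := abs_sub_round (w.re / (2 * Real.pi))
  set m := round (w.re / (2 * Real.pi))
  refine ⟨τ * I + m * (2 * Real.pi), ?_, n, ?_⟩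
  · rw [mem_ball_iff_norm]
    refine (norm_le_abs_re_add_abs_im _).trans_lt ?_
    have h1 : (τ * I + m * (2 * Real.pi) - w : ℂ).re =
        -((w.re / (2 * Real.pi) - m) * (2 * Real.pi)) := by
      field_simp
      simp
      ring
    have h2 : (τ * I + m * (2 * Real.pi) - w : ℂ).im = τ - w.im := by simp
    rw [h1, h2, abs_neg, abs_mul, abs_of_pos (show 0 < 2 * Real.pi by positivity)]
    nlinarith [Real.pi_lt_four]
  · rw [cos_add_int_mul_two_pi, cos_mul_I, ← ofReal_cosh, hn]
    push_cast
    ring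

/-- A Landau-type theorem: holomorphic functions on the disk that omit the natural numbers and
are bounded at the origin have bounded derivative at the origin. -/
theorem norm_deriv_le_of_forall_ne_natCast {F : ℂ → ℂ} (hF : DifferentiableOn ℂ F (ball 0 1))
    (hn : ∀ z ∈ ball (0:ℂ) 1, ∀ n : ℕ, F z ≠ n) (h0 : ‖F 0‖ ≤ 1) : ‖deriv F 0‖ ≤ 1152 := by
  have hz : (0:ℂ) ∈ ball (0:ℂ) 1 := mem_ball_self one_pos
  obtain ⟨h, hh, hcos⟩ := exists_differentiableOn_cos_eq (G := fun z => 2 * F z - 1)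
    ((hF.const_mul 2).sub_const 1)
    (fun z hz h => hn z hz 1 (by push_cast; linear_combination h / 2))
    (fun z hz h => hn z hz 0 (by push_cast; linear_combination h / 2))
  have hd : ‖deriv h 0‖ ≤ 576 := by
    by_contra! hlt
    obtain ⟨w, hw⟩ := exists_ball_subset_image_of_differentiableOn hh
    obtain ⟨v, hv, n, hvn⟩ := exists_cos_eq_mem_ball w
    obtain ⟨z, hz, rfl⟩ := hw (ball_subset_ball (by linarith) hv)
    refine hn z hz n ?_
    linear_combination (hvn - hcos z hz) / 2
  have hsin : ‖sin (h 0)‖ ≤ 4 := by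
    have h1 : sin (h 0) ^ 2 = 1 - (2 * F 0 - 1) ^ 2 := by
      rw [← hcos 0 hz]
      linear_combination sin_sq_add_cos_sq (h 0)
    have h2 : ‖2 * F 0 - 1‖ ≤ 3 := by
      refine (norm_sub_le _ _).trans ?_
      rw [norm_mul, norm_one, Complex.norm_ofNat]
      linarith
    have h3 : ‖sin (h 0)‖ ^ 2 ≤ 1 + 3 ^ 2 := by
      rw [← norm_pow, h1]
      refine (norm_sub_le _ _).trans ?_
      rw [norm_one, norm_pow]
      gcongr
    nlinarith [norm_nonneg (sin (h 0))]
  have hderiv : HasDerivAt F (-sin (h 0) * deriv h 0 / 2) 0 := by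
    have h1 := (((hh.differentiableAt (isOpen_ball.mem_nhds hz)).hasDerivAt.ccos).add_const
      1).div_const 2
    refine h1.congr_of_eventuallyEq ?_
    filter_upwards [isOpen_ball.mem_nhds hz] with z hz
    rw [hcos z hz]
    ring
  rw [hderiv.deriv, norm_div, norm_mul, norm_neg, Complex.norm_ofNat]
  nlinarith [norm_nonneg (sin (h 0)), norm_nonneg (deriv h 0)]

theorem IsRightPeriodic.not_isGromovHyperbolic_of_isPoincareDensity {E : Set ℝ} {t e m g : ℝ}
    (h : IsRightPeriodic E t e m g) {lam : ℂ → ℝ}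
    (hlam : IsPoincareDensity (denjoyDomain E) lam) :
    ¬ IsGromovHyperbolic (denjoyDomain E) (densityDist (denjoyDomain E) lam) :=
  h.not_isGromovHyperbolic_of_landau hlam (by norm_num) fun _ hF hn h0 =>
    norm_deriv_le_of_forall_ne_natCast hF hn h0

end

noncomputable section

/-- Corollary 1.3: a periodic Denjoy domain (with periods indexed by `ℕ` or by `ℤ`) is
Gromov hyperbolic neither for the quasihyperbolic metric nor for the Poincaré metric. -/
theorem periodic_denjoy_not_hyperbolic
    (t : ℝ) (ht : 0 < t) (E₀ : Set ℝ)
    (hcl : IsClosed E₀) (hne : E₀.Nonempty) (hsub : E₀ ⊆ Ico 0 t) :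
    ∀ Ω : Set ℂ,
      (Ω = ((fun x : ℝ => (x : ℂ)) '' ⋃ n : ℕ, (fun x : ℝ => x + t * n) '' E₀)ᶜ ∨
        Ω = ((fun x : ℝ => (x : ℂ)) '' ⋃ n : ℤ, (fun x : ℝ => x + t * n) '' E₀)ᶜ) →
      ¬ IsGromovHyperbolic Ω (qhDist Ω) ∧
        ∀ lam : ℂ → ℝ, IsPoincareDensity Ω lam →
          ¬ IsGromovHyperbolic Ω (densityDist Ω lam) := by
  intro Ω hΩ
  obtain ⟨T, hT, rfl⟩ : ∃ T : Set ℤ, (∀ n : ℕ, (n : ℤ) ∈ T) ∧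
      Ω = denjoyDomain {x | ∃ y ∈ E₀, ∃ n ∈ T, y + t * n = x} := by
    rcases hΩ with rfl | rfl
    · refine ⟨range ((↑) : ℕ → ℤ), mem_range_self, congrArg (fun s => (_ '' s)ᶜ) ?_⟩
      ext x
      simp only [mem_iUnion, mem_image, mem_ofPred_eq]
      constructor
      · rintro ⟨n, y, hy, h⟩
        exact ⟨y, hy, n, mem_range_self n, by simpa using h⟩
      · rintro ⟨y, hy, _, ⟨n, rfl⟩, h⟩
        exact ⟨n, y, hy, by simpa using h⟩
    · refine ⟨univ, fun _ => mem_univ _, congrArg (fun s => (_ '' s)ᶜ) ?_⟩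
      ext x
      simp only [mem_iUnion, mem_image, mem_ofPred_eq, mem_univ, true_and]
      exact ⟨fun ⟨n, y, hy, h⟩ => ⟨y, hy, n, h⟩, fun ⟨y, hy, n, h⟩ => ⟨n, y, hy, h⟩⟩
  obtain ⟨e, m, g, h⟩ := exists_isRightPeriodic ht hcl hne hsub hT
  exact ⟨h.not_isGromovHyperbolic_qhDist, fun _ => h.not_isGromovHyperbolic_of_isPoincareDensity⟩

end
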